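/- arXiv:1304.0036 — 2 statements merged into one kernel-verified Lean document; each statement's English description precedes it below -/
import Mathlib

section
/- Let d ≥ 2 and k ≥ 1 be integers and let ρ₀, ρ₁, …, ρ_k be probability vectors on Fin d. Set ΔS = H(ρ_k) - H(ρ₀). Then ∑_{j=1}^{k} D(ρ_{j-1}‖ρ_j) ≥ k · M(-ΔS/k, d) ≥ (ΔS)² / (3·k·(log d)²) (inequalities in [0,∞]). -/
open scoped ENNReal BigOperators

noncomputable section

/-- Binary entropy (natural log), with Lean's convention `Real.log 0 = 0`. -/
def binEntropy' (x : ℝ) : ℝ := -(x * Real.log x) - (1 - x) * Real.log (1 - x)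

/-- Binary relative entropy, valued in `[0,∞]`. -/
def binRelEntropy (x y : ℝ) : ℝ≥0∞ :=
  if (y = 0 ∧ 0 < x) ∨ (y = 1 ∧ x < 1) then ⊤
  else ENNReal.ofReal (x * Real.log (x / y) + (1 - x) * Real.log ((1 - x) / (1 - y)))

/-- `M(Δ,d)`: infimum of binary relative entropies under the entropy-difference constraint. -/
def Mfun (Δ : ℝ) (d : ℕ) : ℝ≥0∞ :=
  sInf {m : ℝ≥0∞ | ∃ s r : ℝ, s ∈ Set.Icc (0:ℝ) (((d:ℝ) - 1) / d) ∧
    r ∈ Set.Icc (0:ℝ) (((d:ℝ) - 1) / d) ∧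
    binEntropy' s - binEntropy' r + (s - r) * Real.log ((d:ℝ) - 1) = Δ ∧
    m = binRelEntropy s r}

/-- Shannon entropy of a probability vector on `Fin d` (natural log). -/
def shEntropy {d : ℕ} (p : Fin d → ℝ) : ℝ := ∑ i, -(p i * Real.log (p i))

/-- Relative entropy between probability vectors on `Fin d`, valued in `[0,∞]`. -/
def relEntropy {d : ℕ} (p q : Fin d → ℝ) : ℝ≥0∞ :=
  if ∀ i, q i = 0 → p i = 0
  then ENNReal.ofReal (∑ i, p i * Real.log (p i / q i))
  else ⊤

/-- `N(d) = sup_{0<r<1/2} r(1-r) (log(((1-r)/r)(d-1)))²`. -/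
def Nfun (d : ℕ) : ℝ :=
  sSup {v : ℝ | ∃ r : ℝ, 0 < r ∧ r < 1/2 ∧
    v = r * (1 - r) * (Real.log ((1 - r) / r * ((d:ℝ) - 1)))^2}

section

open Real Set Filter Topology


/-- The derivative of the `d`-ary entropy `Real.qaryEntropy d`. -/
def entropySlope (d : ℕ) (r : ℝ) : ℝ := log ((d : ℝ) - 1) + log (1 - r) - log r

lemma log_odds_le {r : ℝ} (h0 : 0 < r) (h1 : r < 1) :
    √r * (log (1 - r) - log r) ≤ 2 / exp 1 * √(1 - r) := by
  have hu : 0 < √r := sqrt_pos.2 h0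
  have hv : 0 < √(1 - r) := sqrt_pos.2 (by linarith)
  have h2 : log (1 - r) - log r = 2 * log (√(1 - r) / √r) := by
    rw [log_div hv.ne' hu.ne', log_sqrt (by linarith), log_sqrt h0.le]; ring
  have h3 : log (√(1 - r) / √r) ≤ √(1 - r) / √r / exp 1 := by
    have := log_le_sub_one_of_pos (x := √(1 - r) / √r / exp 1) (by positivity)
    rw [log_div (by positivity) (exp_pos 1).ne', log_exp] at this
    linarith
  rw [h2]
  calc √r * (2 * log (√(1 - r) / √r)) ≤ √r * (2 * (√(1 - r) / √r / exp 1)) := by gcongr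
    _ = _ := by field_simp

lemma neg_one_sub_mul_log_one_sub_le {r : ℝ} (h1 : r < 1) : -((1 - r) * log (1 - r)) ≤ r := by
  have h : 0 < 1 - r := by linarith
  have := one_sub_inv_le_log_of_pos h
  have h2 := mul_le_mul_of_nonneg_left this h.le
  rw [mul_sub, mul_inv_cancel₀ h.ne'] at h2
  linarith

lemma log_odds_mul_le_one {r : ℝ} (h0 : 0 < r) (h1 : r < 1) :
    (1 - r) * (2 * r * (log (1 - r) - log r) - log (1 - r)) ≤ 1 := by
  have hy := log_odds_le h0 h1
  have hl := neg_one_sub_mul_log_one_sub_le h1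
  have hu : 0 < √r := sqrt_pos.2 h0
  have hv : 0 < √(1 - r) := sqrt_pos.2 (by linarith)
  have hu2 : √r ^ 2 = r := sq_sqrt h0.le
  have hv2 : √(1 - r) ^ 2 = 1 - r := sq_sqrt (by linarith)
  have he : 2 / exp 1 ≤ 1 := by
    rw [div_le_one (exp_pos 1)]; linarith [exp_one_gt_d9]
  have hy1 : √r * (log (1 - r) - log r) ≤ √(1 - r) :=
    hy.trans (by nlinarith)
  have h3 : √r * (√r * (log (1 - r) - log r)) ≤ √r * √(1 - r) := by gcongr
  have h4 : r * (log (1 - r) - log r) ≤ 1 / 2 := by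
    have : r * (log (1 - r) - log r) = √r * (√r * (log (1 - r) - log r)) := by
      rw [← mul_assoc, ← pow_two, hu2]
    rw [this]; nlinarith [sq_nonneg (√r - √(1 - r))]
  nlinarith

lemma log_odds_mul_entropy_le {r : ℝ} (h0 : 0 < r) (h1 : r < 1) :
    (1 - r) * (log (1 - r) - log r) * (r * (log (1 - r) - log r) - log (1 - r)) ≤
      3 / 2 * log 2 ^ 2 := by
  have hy := log_odds_le h0 h1
  have hl := neg_one_sub_mul_log_one_sub_le h1
  have hl2 := log_two_gt_d9
  set y := log (1 - r) - log r with hydef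
  have hu : 0 < √r := sqrt_pos.2 h0
  have hv : 0 < √(1 - r) := sqrt_pos.2 (by linarith)
  have hu2 : √r ^ 2 = r := sq_sqrt h0.le
  have hv2 : √(1 - r) ^ 2 = 1 - r := sq_sqrt (by linarith)
  rcases le_or_gt y 0 with hneg | hpos
  · have hH : 0 ≤ r * y - log (1 - r) := by
      have := binEntropy_nonneg h0.le h1.le
      simp only [binEntropy, log_inv] at this
      simp only [hydef]; linarith
    have : (1 - r) * y ≤ 0 := by nlinarith
    nlinarith [sq_nonneg (log 2)]
  set u := √r
  set v := √(1 - r)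
  have he : 2 / exp 1 ≤ 0.7358 := by
    rw [div_le_iff₀ (exp_pos 1)]; linarith [exp_one_gt_d9]
  have huy : u * y ≤ 0.7358 * v := hy.trans (by nlinarith)
  have hsq : (u * y) ^ 2 ≤ (0.7358 * v) ^ 2 := by gcongr
  have h3 : (1 - r) * y * (r * y - log (1 - r)) ≤ v ^ 2 * (u * y) ^ 2 + u * (u * y) := by
    rw [hv2, mul_pow, hu2, ← mul_assoc u u y, ← pow_two, hu2]
    nlinarith
  have h4 : v ^ 2 * (u * y) ^ 2 + u * (u * y) ≤ v ^ 2 * (0.7358 * v) ^ 2 + u * (0.7358 * v) := by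
    gcongr
  have h5 : u * v ≤ 0.125 + 2 * r * (1 - r) := by
    have : 2 * r * (1 - r) = 2 * (u * v) ^ 2 := by rw [mul_pow, hu2, hv2]; ring
    nlinarith [sq_nonneg (u * v - 1 / 4)]
  have h6 : v ^ 2 * (0.7358 * v) ^ 2 = 0.7358 ^ 2 * (1 - r) ^ 2 := by rw [← hv2]; ring
  nlinarith [sq_nonneg (r - 0.209)]

lemma entropySlope_mul_entropy_le {d : ℕ} (hd : 2 ≤ d) {r : ℝ} (h0 : 0 < r) (h1 : r < 1) :
    (1 - r) * entropySlope d r * qaryEntropy d r ≤ 3 / 2 * log d ^ 2 := by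
  have hd' : (2 : ℝ) ≤ d := by exact_mod_cast hd
  have hT : 0 ≤ log ((d : ℝ) - 1) := log_nonneg (by linarith)
  have hP : log 2 + log ((d : ℝ) - 1) / 2 ≤ log d := by
    rw [← log_sqrt (by linarith), ← log_mul (by norm_num) (sqrt_pos.2 (by linarith)).ne']
    apply log_le_log (by have := sqrt_pos.2 (show (0 : ℝ) < d - 1 by linarith); positivity)
    nlinarith [sq_nonneg (√((d : ℝ) - 1) - 1), sq_sqrt (show (0 : ℝ) ≤ d - 1 by linarith)]
  have hc0 := log_odds_mul_entropy_le h0 h1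
  have hc1 := log_odds_mul_le_one h0 h1
  have hl2 := log_two_gt_d9
  have hP2 : (log 2 + log ((d : ℝ) - 1) / 2) ^ 2 ≤ log d ^ 2 := by gcongr
  have hq : qaryEntropy d r = r * log ((d : ℝ) - 1) + r * (log (1 - r) - log r) - log (1 - r) := by
    simp [qaryEntropy, binEntropy]; ring
  rw [hq, entropySlope]
  set T := log ((d : ℝ) - 1)
  have h14 : r * (1 - r) ≤ 1 / 4 := by nlinarith [sq_nonneg (r - 1 / 2)]
  have hT2 : r * (1 - r) * T ^ 2 ≤ 1 / 4 * T ^ 2 := by gcongr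
  have hT1 := mul_le_mul_of_nonneg_left hc1 hT
  nlinarith

lemma hasDerivAt_entropySlope {d : ℕ} {r : ℝ} (h0 : 0 < r) (h1 : r < 1) :
    HasDerivAt (qaryEntropy d) (entropySlope d r) r :=
  hasDerivAt_qaryEntropy h0.ne' h1.ne

/-- The entropy lies below its tangent lines. -/
lemma qaryEntropy_le_tangent {d : ℕ} {s r : ℝ} (hs0 : 0 ≤ s) (hs1 : s ≤ 1)
    (h0 : 0 < r) (h1 : r < 1) :
    qaryEntropy d s ≤ qaryEntropy d r + entropySlope d r * (s - r) := by
  have hc := (strictConcaveOn_qaryEntropy (q := d)).concaveOn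
  have hdr := hasDerivAt_entropySlope (d := d) h0 h1
  rcases lt_trichotomy s r with h | h | h
  · have := hc.le_slope_of_hasDerivAt ⟨hs0, hs1⟩ ⟨h0.le, h1.le⟩ h hdr
    rw [slope_def_field, le_div_iff₀ (by linarith)] at this
    linarith
  · subst h; simp
  · have := hc.slope_le_of_hasDerivAt ⟨h0.le, h1.le⟩ ⟨hs0, hs1⟩ h hdr
    rw [slope_def_field, div_le_iff₀ (by linarith)] at this
    linarith

lemma entropySlope_mul_le_qaryEntropy {d : ℕ} {r : ℝ} (h0 : 0 < r) (h1 : r < 1) :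
    r * entropySlope d r ≤ qaryEntropy d r := by
  have : log (1 - r) ≤ 0 := log_nonpos (by linarith) (by linarith)
  have hq : qaryEntropy d r = r * entropySlope d r - log (1 - r) := by
    simp [qaryEntropy, binEntropy, entropySlope]; ring
  linarith

lemma entropySlope_nonneg {d : ℕ} (hd : 2 ≤ d) {r : ℝ} (h0 : 0 < r)
    (h1 : r ≤ ((d : ℝ) - 1) / d) : 0 ≤ entropySlope d r := by
  have hd' : (2 : ℝ) ≤ d := by exact_mod_cast hd
  rw [le_div_iff₀ (by linarith)] at h1
  have h1r : 0 < 1 - r := by nlinarith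
  rw [entropySlope, ← log_mul (by linarith) h1r.ne', sub_nonneg]
  exact log_le_log h0 (by linarith)

lemma entropySlope_pos {d : ℕ} (hd : 2 ≤ d) {r : ℝ} (h0 : 0 < r)
    (h1 : r < ((d : ℝ) - 1) / d) : 0 < entropySlope d r := by
  have hd' : (2 : ℝ) ≤ d := by exact_mod_cast hd
  rw [lt_div_iff₀ (by linarith)] at h1
  have h1r : 0 < 1 - r := by nlinarith
  rw [entropySlope, ← log_mul (by linarith) h1r.ne', sub_pos]
  exact log_lt_log h0 (by linarith)

lemma range_bound_lt_one {d : ℕ} (hd : 2 ≤ d) : ((d : ℝ) - 1) / d < 1 := by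
  have hd' : (2 : ℝ) ≤ d := by exact_mod_cast hd
  rw [div_lt_one (by linarith)]; linarith

lemma range_bound_pos {d : ℕ} (hd : 2 ≤ d) : 0 < ((d : ℝ) - 1) / d := by
  have hd' : (2 : ℝ) ≤ d := by exact_mod_cast hd
  apply div_pos <;> linarith

lemma range_bound_eq {d : ℕ} (hd : 2 ≤ d) : ((d : ℝ) - 1) / d = 1 - 1 / d := by
  have hd' : (2 : ℝ) ≤ d := by exact_mod_cast hd
  field_simp

/-- The slope of the chord of the entropy between `s` and `r` is at most `qaryEntropy d r / r`. -/
lemma abs_entropy_sub_mul_le {d : ℕ} (hd : 2 ≤ d) {s r : ℝ}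
    (hs : s ∈ Icc (0 : ℝ) (((d : ℝ) - 1) / d)) (h0 : 0 < r) (h1 : r ≤ ((d : ℝ) - 1) / d) :
    |qaryEntropy d s - qaryEntropy d r| * r ≤ qaryEntropy d r * |s - r| := by
  have hr1 : r < 1 := h1.trans_lt (range_bound_lt_one hd)
  have hs1 : s < 1 := hs.2.trans_lt (range_bound_lt_one hd)
  have hmono := (qaryEntropy_strictMonoOn hd).monotoneOn
  rw [← range_bound_eq hd] at hmono
  rcases le_total s r with h | h
  · have h2 := hmono hs ⟨h0.le, h1⟩ h
    rw [abs_of_nonpos (by linarith), abs_of_nonpos (by linarith)]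
    have hc := (strictConcaveOn_qaryEntropy (q := d)).concaveOn.2
      (show (0 : ℝ) ∈ Icc (0 : ℝ) 1 by simp) (show r ∈ Icc (0 : ℝ) 1 from ⟨h0.le, hr1.le⟩)
      (show 0 ≤ 1 - s / r by rw [sub_nonneg, div_le_one h0]; exact h)
      (show 0 ≤ s / r from div_nonneg hs.1 h0.le) (by ring)
    have e : s / r * r = s := div_mul_cancel₀ _ h0.ne'
    simp only [smul_eq_mul, qaryEntropy_zero, mul_zero, zero_add, e] at hc
    rw [div_mul_eq_mul_div, div_le_iff₀ h0] at hc
    linarith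
  · have h2 := hmono ⟨h0.le, h1⟩ hs h
    rw [abs_of_nonneg (by linarith), abs_of_nonneg (by linarith)]
    have h3 := qaryEntropy_le_tangent (d := d) hs.1 hs1.le h0 hr1
    have h4 := entropySlope_mul_le_qaryEntropy (d := d) h0 hr1
    nlinarith

/-- The real-valued binary relative entropy. -/
def binKL (s r : ℝ) : ℝ := s * log (s / r) + (1 - s) * log ((1 - s) / (1 - r))

lemma binKL_eq {d : ℕ} {s r : ℝ} (hs1 : s < 1) (h0 : 0 < r) (h1 : r < 1) :
    binKL s r = qaryEntropy d r - qaryEntropy d s + entropySlope d r * (s - r) := by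
  have h : s * log (s / r) = s * log s - s * log r := by
    rcases eq_or_ne s 0 with rfl | hs
    · simp
    · rw [log_div hs h0.ne']; ring
  rw [binKL, h, log_div (by linarith) (by linarith)]
  simp [qaryEntropy, binEntropy, entropySlope]
  ring

lemma sq_entropy_sub_le_binKL {d : ℕ} (hd : 2 ≤ d) {s r : ℝ}
    (hs : s ∈ Icc (0 : ℝ) (((d : ℝ) - 1) / d)) (h0 : 0 < r) (h1 : r ≤ ((d : ℝ) - 1) / d) :
    (qaryEntropy d s - qaryEntropy d r) ^ 2 / (3 * log d ^ 2) ≤ binKL s r := by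
  have hd' : (2 : ℝ) ≤ d := by exact_mod_cast hd
  have hb1 := range_bound_lt_one hd
  have hs1 : s < 1 := hs.2.trans_lt hb1
  have hr1 : r < 1 := h1.trans_lt hb1
  have hlog : 0 < log d := log_pos (by linarith)
  set C := 3 * log (d : ℝ) ^ 2 with hC
  have hCpos : 0 < C := by positivity
  let φ : ℝ → ℝ := fun t => qaryEntropy d t - qaryEntropy d s + entropySlope d t * (s - t) -
    (qaryEntropy d s - qaryEntropy d t) ^ 2 / C
  let φ' : ℝ → ℝ := fun t => (t - s) / (t * (1 - t)) +
    2 * (qaryEntropy d s - qaryEntropy d t) * entropySlope d t / C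
  have hslope : ∀ t, 0 < t → t < 1 → HasDerivAt (entropySlope d) (-(1 / (t * (1 - t)))) t := by
    intro t ht0 ht1
    have ht1' : 1 - t ≠ 0 := by linarith
    have := ((((hasDerivAt_id t).const_sub 1).log ht1').const_add (log ((d : ℝ) - 1))).sub
      (hasDerivAt_log ht0.ne')
    convert! this using 1
    simp; field_simp; ring
  have hφ : ∀ t, 0 < t → t < 1 → HasDerivAt φ (φ' t) t := by
    intro t ht0 ht1
    have hq := hasDerivAt_entropySlope (d := d) ht0 ht1
    have := ((hq.sub_const (qaryEntropy d s)).add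
      ((hslope t ht0 ht1).mul ((hasDerivAt_id t).const_sub s))).sub
      (((hq.const_sub (qaryEntropy d s)).pow 2).div_const C)
    convert! this using 1
    have ht1' : 1 - t ≠ 0 := by linarith
    simp [φ']; field_simp; ring
  have key : ∀ t, 0 < t → t ≤ ((d : ℝ) - 1) / d →
      |2 * (qaryEntropy d s - qaryEntropy d t) * entropySlope d t / C| ≤
        |s - t| / (t * (1 - t)) := by
    intro t ht0 ht1
    have ht1' : t < 1 := ht1.trans_lt hb1
    have hL := entropySlope_nonneg hd ht0 ht1
    have h2 := abs_entropy_sub_mul_le hd hs ht0 ht1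
    have h3 := entropySlope_mul_entropy_le hd ht0 ht1'
    have h1t : 0 < 1 - t := by linarith
    rw [abs_div, abs_mul, abs_mul, abs_of_pos hCpos, abs_of_nonneg hL, abs_two,
      div_le_div_iff₀ hCpos (by positivity)]
    calc 2 * |qaryEntropy d s - qaryEntropy d t| * entropySlope d t * (t * (1 - t))
        = 2 * (|qaryEntropy d s - qaryEntropy d t| * t) * (entropySlope d t * (1 - t)) := by ring
      _ ≤ 2 * (qaryEntropy d t * |s - t|) * (entropySlope d t * (1 - t)) := by gcongr
      _ = 2 * |s - t| * ((1 - t) * entropySlope d t * qaryEntropy d t) := by ring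
      _ ≤ 2 * |s - t| * (3 / 2 * log d ^ 2) := by gcongr
      _ = |s - t| * C := by rw [hC]; ring
  suffices 0 ≤ φ r by
    rw [binKL_eq (d := d) hs1 h0 hr1]; simpa [φ] using this
  have hφs : φ s = 0 := by simp [φ]
  rcases le_total s r with h | h
  · have hcont : ContinuousOn φ (Icc s r) := by
      rcases hs.1.eq_or_lt with hs0 | hs0
      · have e : φ = fun t => (-log (1 - t)) - (qaryEntropy d t) ^ 2 / C := by
          funext t
          simp [φ, ← hs0, qaryEntropy, binEntropy, entropySlope]; ring
        rw [e]
        refine ContinuousOn.sub (ContinuousOn.neg (ContinuousOn.log (by fun_prop) ?_)) (by fun_prop)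
        intro t ht
        have := ht.2
        linarith
      · exact fun t ht =>
          (hφ t (hs0.trans_le ht.1) (ht.2.trans_lt hr1)).continuousAt.continuousWithinAt
    have hmono : MonotoneOn φ (Icc s r) := by
      refine monotoneOn_of_hasDerivWithinAt_nonneg (f' := φ') (convex_Icc s r) hcont ?_ ?_ <;>
        rw [interior_Icc] <;> intro t ht
      · exact (hφ t (hs.1.trans_lt ht.1) (ht.2.trans hr1)).hasDerivWithinAt
      · have := key t (hs.1.trans_lt ht.1) (ht.2.le.trans h1)
        rw [abs_of_neg (sub_neg.2 ht.1)] at this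
        have h4 := neg_le_of_abs_le this
        have h5 : -(s - t) / (t * (1 - t)) = (t - s) / (t * (1 - t)) := by ring
        simp only [φ']
        linarith
    have := hmono ⟨le_refl s, h⟩ ⟨h, le_refl r⟩ h
    linarith
  · have hanti : AntitoneOn φ (Icc r s) := by
      refine antitoneOn_of_hasDerivWithinAt_nonpos (f' := φ') (convex_Icc r s)
        (fun t ht => (hφ t (h0.trans_le ht.1)
          (ht.2.trans_lt hs1)).continuousAt.continuousWithinAt) ?_ ?_ <;>
        rw [interior_Icc] <;> intro t ht
      · exact (hφ t (h0.trans ht.1) (ht.2.trans hs1)).hasDerivWithinAt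
      · have := key t (h0.trans ht.1) (ht.2.le.trans hs.2)
        rw [abs_of_pos (sub_pos.2 ht.2)] at this
        have h4 := le_of_abs_le this
        have h5 : (s - t) / (t * (1 - t)) = -((t - s) / (t * (1 - t))) := by ring
        simp only [φ']
        linarith
    have := hanti ⟨le_refl r, h⟩ ⟨h, le_refl s⟩ h
    linarith

lemma binEntropy'_add {d : ℕ} (x : ℝ) :
    binEntropy' x + x * log ((d : ℝ) - 1) = qaryEntropy d x := by
  simp [binEntropy', qaryEntropy, binEntropy]; ring

lemma binEntropy'_constraint {d : ℕ} (s r : ℝ) :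
    binEntropy' s - binEntropy' r + (s - r) * log ((d : ℝ) - 1) =
      qaryEntropy d s - qaryEntropy d r := by
  rw [← binEntropy'_add, ← binEntropy'_add]; ring

lemma binRelEntropy_eq_ofReal {s r : ℝ} (h0 : 0 < r) (h1 : r < 1) :
    binRelEntropy s r = ENNReal.ofReal (binKL s r) := by
  rw [binRelEntropy, if_neg (by rintro (⟨h, -⟩ | ⟨h, -⟩) <;> linarith), binKL]

/-- The quadratic lower bound on `Mfun`. -/
lemma ofReal_sq_le_Mfun {d : ℕ} (hd : 2 ≤ d) (Δ : ℝ) :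
    ENNReal.ofReal (Δ ^ 2 / (3 * log d ^ 2)) ≤ Mfun Δ d := by
  refine le_sInf ?_
  rintro m ⟨s, r, hs, hr, hΔ, rfl⟩
  rw [binEntropy'_constraint] at hΔ
  rcases hr.1.eq_or_lt with h0 | h0
  · subst h0
    rcases hs.1.eq_or_lt with hs0 | hs0
    · subst hs0; simp [← hΔ]
    · simp [binRelEntropy, hs0]
  · rw [binRelEntropy_eq_ofReal h0 (hr.2.trans_lt (range_bound_lt_one hd)), ← hΔ]
    exact ENNReal.ofReal_le_ofReal (sq_entropy_sub_le_binKL hd hs h0 hr.2)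

/-! ### Uniqueness of the critical point -/

lemma sinh_lt_self_mul_cosh {y : ℝ} (hy : 0 < y) : sinh y < y * cosh y := by
  have hm : StrictMonoOn (fun t => t * cosh t - sinh t) (Ici 0) := by
    refine strictMonoOn_of_hasDerivWithinAt_pos (f' := fun t => t * sinh t) (convex_Ici 0)
      (by fun_prop) ?_ ?_ <;> rw [interior_Ici] <;> intro t ht
    · have := ((hasDerivAt_id t).mul (hasDerivAt_cosh t)).sub (hasDerivAt_sinh t)
      refine HasDerivAt.hasDerivWithinAt ?_
      convert! this using 1
      simp
    · exact mul_pos ht (sinh_pos_iff.2 ht)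
  have := hm (mem_Ici.2 le_rfl) (mem_Ici.2 hy.le) hy
  simp at this
  linarith

lemma two_mul_cosh_sub_one_lt {x : ℝ} (hx : 0 < x) : 2 * (cosh x - 1) < x * sinh x := by
  have h := sinh_lt_self_mul_cosh (half_pos hx)
  have hs : 0 < sinh (x / 2) := sinh_pos_iff.2 (half_pos hx)
  have e : x = 2 * (x / 2) := by ring
  have hc : cosh x = 1 + 2 * sinh (x / 2) ^ 2 := by
    rw [e, cosh_two_mul, cosh_sq]; ring_nf
  have hs2 : sinh x = 2 * sinh (x / 2) * cosh (x / 2) := by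
    nth_rw 1 [e]; rw [sinh_two_mul]
  rw [hc, hs2]
  nlinarith

lemma sq_mul_exp_lt {x : ℝ} (hx : 0 < x) : x ^ 2 * exp x < (exp x - 1) ^ 2 := by
  have h : x / 2 < sinh (x / 2) := self_lt_sinh_iff.2 (half_pos hx)
  rw [sinh_eq] at h
  have e1 : exp x = exp (x / 2) ^ 2 := by rw [← exp_nat_mul]; congr 1; push_cast; ring
  have e2 : exp (-(x / 2)) * exp (x / 2) = 1 := by rw [← exp_add]; simp
  have hp := exp_pos (x / 2)
  have h2 : x * exp (x / 2) < exp x - 1 := by rw [e1]; nlinarith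
  calc x ^ 2 * exp x = (x * exp (x / 2)) ^ 2 := by rw [e1]; ring
    _ < _ := by gcongr

lemma strictMonoOn_critical_ratio_of_lt_one {a : ℝ} (ha0 : 0 < a) (ha1 : a < 1) :
    StrictMonoOn (fun x => (a * (exp x - 1) - x) / (x - a * (1 - exp (-x)))) (Ioi 0) := by
  have hden : ∀ x : ℝ, 0 < x → 0 < x - a * (1 - exp (-x)) := by
    intro x hx
    have h1 := add_one_le_exp (-x)
    nlinarith
  have hd : ∀ x : ℝ, 0 < x → HasDerivAt
      (fun x => (a * (exp x - 1) - x) / (x - a * (1 - exp (-x))))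
      (2 * a * (x * sinh x - (a + 1) * (cosh x - 1)) / (x - a * (1 - exp (-x))) ^ 2) x := by
    intro x hx
    have hn := (((hasDerivAt_exp x).sub_const 1).const_mul a).sub (hasDerivAt_id x)
    have hm := (hasDerivAt_id x).sub
      ((((hasDerivAt_id x).neg.exp).const_sub 1).const_mul a)
    have := hn.div hm (hden x hx).ne'
    convert! this using 1
    congr 1
    have e : exp x * exp (-x) = 1 := by rw [← exp_add]; simp
    simp only [id, sinh_eq, cosh_eq, Pi.neg_apply, Pi.sub_apply]
    linear_combination (-2 * a ^ 2) * e
  refine strictMonoOn_of_hasDerivWithinAt_pos (convex_Ioi 0)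
    (fun x hx => (hd x hx).continuousAt.continuousWithinAt)
    (f' := fun x => 2 * a * (x * sinh x - (a + 1) * (cosh x - 1)) / (x - a * (1 - exp (-x))) ^ 2)
    ?_ ?_ <;> rw [interior_Ioi] <;> intro x hx
  · exact (hd x hx).hasDerivWithinAt
  · have h1 := two_mul_cosh_sub_one_lt hx
    have h2 : 1 < cosh x := one_lt_cosh.2 (ne_of_gt hx)
    have h3 := hden x hx
    have h4 : 0 < x * sinh x - (a + 1) * (cosh x - 1) := by nlinarith
    positivity

lemma strictMonoOn_critical_ratio_of_one_lt {a : ℝ} (ha1 : 1 < a) :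
    StrictMonoOn (fun x => x * (exp x - 1) / (a * (exp x - 1) - x)) (Ioi 0) := by
  have hden : ∀ x : ℝ, 0 < x → 0 < a * (exp x - 1) - x := by
    intro x hx
    have h1 := add_one_le_exp x
    nlinarith
  have hd : ∀ x : ℝ, 0 < x → HasDerivAt
      (fun x => x * (exp x - 1) / (a * (exp x - 1) - x))
      ((a * (exp x - 1) ^ 2 - x ^ 2 * exp x) / (a * (exp x - 1) - x) ^ 2) x := by
    intro x hx
    have he := (hasDerivAt_exp x).sub_const 1
    have := ((hasDerivAt_id x).mul he).div ((he.const_mul a).sub (hasDerivAt_id x)) (hden x hx).ne'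
    convert! this using 1
    congr 1
    simp only [id, Pi.mul_apply, Pi.sub_apply]
    ring
  refine strictMonoOn_of_hasDerivWithinAt_pos (convex_Ioi 0)
    (fun x hx => (hd x hx).continuousAt.continuousWithinAt)
    (f' := fun x => (a * (exp x - 1) ^ 2 - x ^ 2 * exp x) / (a * (exp x - 1) - x) ^ 2)
    ?_ ?_ <;> rw [interior_Ioi] <;> intro x hx
  · exact (hd x hx).hasDerivWithinAt
  · have h1 := sq_mul_exp_lt hx
    have h3 := hden x hx
    have h4 : 0 < a * (exp x - 1) ^ 2 - x ^ 2 * exp x := by nlinarith [sq_nonneg (exp x - 1)]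
    positivity

/-- The equation satisfied by the log-odds `ℓ` of the extremal two-valued distribution. -/
def IsCritical (n a ℓ : ℝ) : Prop :=
  a * (n + exp ℓ) * (1 - exp ((a - 1) * ℓ)) = (1 - a) * ℓ * (n + exp (a * ℓ))

lemma IsCritical.not_lt {n a ℓ₁ ℓ₂ : ℝ} (hn : 0 < n) (ha0 : 0 < a) (ha1 : a ≠ 1)
    (h₁ : 0 < ℓ₁) (hc₁ : IsCritical n a ℓ₁) (hc₂ : IsCritical n a ℓ₂) : ¬ ℓ₁ < ℓ₂ := by
  intro hlt
  have h₂ : 0 < ℓ₂ := h₁.trans hlt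
  rcases ha1.lt_or_gt with ha1 | ha1
  · have hden : ∀ x : ℝ, 0 < x → 0 < x - a * (1 - exp (-x)) := by
      intro x hx
      have h1 := add_one_le_exp (-x)
      nlinarith
    have key : ∀ ℓ, 0 < ℓ → IsCritical n a ℓ → exp (a * ℓ) *
        ((a * (exp ((1 - a) * ℓ) - 1) - (1 - a) * ℓ) /
          ((1 - a) * ℓ - a * (1 - exp (-((1 - a) * ℓ))))) = n := by
      intro ℓ hℓ hc
      have hx : 0 < (1 - a) * ℓ := mul_pos (by linarith) hℓ
      rw [← mul_div_assoc, div_eq_iff (hden _ hx).ne']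
      have e1 : exp ℓ = exp (a * ℓ) * exp ((1 - a) * ℓ) := by rw [← exp_add]; ring_nf
      have e2 : exp ((1 - a) * ℓ) * exp (-((1 - a) * ℓ)) = 1 := by rw [← exp_add]; simp
      rw [IsCritical, e1, show (a - 1) * ℓ = -((1 - a) * ℓ) by ring] at hc
      linear_combination hc + a * exp (a * ℓ) * e2
    have hm := strictMonoOn_critical_ratio_of_lt_one ha0 ha1
      (show (1 - a) * ℓ₁ ∈ Ioi (0 : ℝ) from mul_pos (by linarith) h₁)
      (show (1 - a) * ℓ₂ ∈ Ioi (0 : ℝ) from mul_pos (by linarith) h₂)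
      (mul_lt_mul_of_pos_left hlt (by linarith))
    have k1 := key ℓ₁ h₁ hc₁
    have k2 := key ℓ₂ h₂ hc₂
    simp only at hm
    set T₁ := (a * (exp ((1 - a) * ℓ₁) - 1) - (1 - a) * ℓ₁) /
          ((1 - a) * ℓ₁ - a * (1 - exp (-((1 - a) * ℓ₁))))
    set T₂ := (a * (exp ((1 - a) * ℓ₂) - 1) - (1 - a) * ℓ₂) /
          ((1 - a) * ℓ₂ - a * (1 - exp (-((1 - a) * ℓ₂))))
    have hT : 0 < T₁ := pos_of_mul_pos_right (k1 ▸ hn) (exp_pos _).le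
    have he : exp (a * ℓ₁) < exp (a * ℓ₂) := exp_lt_exp.2 (by nlinarith)
    have := mul_lt_mul he hm.le hT (exp_pos (a * ℓ₂)).le
    linarith
  · have hden : ∀ x : ℝ, 0 < x → 0 < a * (exp x - 1) - x := by
      intro x hx
      have h1 := add_one_le_exp x
      nlinarith
    have key : ∀ ℓ, 0 < ℓ → IsCritical n a ℓ → exp ℓ *
        ((a - 1) * ℓ * (exp ((a - 1) * ℓ) - 1) /
          (a * (exp ((a - 1) * ℓ) - 1) - (a - 1) * ℓ) - 1) = n := by
      intro ℓ hℓ hc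
      have hx : 0 < (a - 1) * ℓ := mul_pos (by linarith) hℓ
      have e1 : exp (a * ℓ) = exp ℓ * exp ((a - 1) * ℓ) := by rw [← exp_add]; ring_nf
      rw [IsCritical, e1] at hc
      rw [div_sub_one (hden _ hx).ne', ← mul_div_assoc, div_eq_iff (hden _ hx).ne']
      linear_combination hc
    have hm := strictMonoOn_critical_ratio_of_one_lt ha1
      (show (a - 1) * ℓ₁ ∈ Ioi (0 : ℝ) from mul_pos (by linarith) h₁)
      (show (a - 1) * ℓ₂ ∈ Ioi (0 : ℝ) from mul_pos (by linarith) h₂)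
      (mul_lt_mul_of_pos_left hlt (by linarith))
    have k1 := key ℓ₁ h₁ hc₁
    have k2 := key ℓ₂ h₂ hc₂
    simp only at hm
    set T₁ := (a - 1) * ℓ₁ * (exp ((a - 1) * ℓ₁) - 1) /
          (a * (exp ((a - 1) * ℓ₁) - 1) - (a - 1) * ℓ₁)
    set T₂ := (a - 1) * ℓ₂ * (exp ((a - 1) * ℓ₂) - 1) /
          (a * (exp ((a - 1) * ℓ₂) - 1) - (a - 1) * ℓ₂)
    have hT : 0 < T₁ - 1 := pos_of_mul_pos_right (k1 ▸ hn) (exp_pos _).le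
    have := mul_lt_mul (exp_lt_exp.2 hlt) (sub_le_sub_right hm.le 1) hT (exp_pos ℓ₂).le
    linarith

lemma IsCritical.unique {n a ℓ₁ ℓ₂ : ℝ} (hn : 0 < n) (ha0 : 0 < a) (ha1 : a ≠ 1)
    (h₁ : 0 < ℓ₁) (h₂ : 0 < ℓ₂) (hc₁ : IsCritical n a ℓ₁) (hc₂ : IsCritical n a ℓ₂) : ℓ₁ = ℓ₂ :=
  le_antisymm (_root_.not_lt.1 (hc₂.not_lt hn ha0 ha1 h₂ hc₁))
    (_root_.not_lt.1 (hc₁.not_lt hn ha0 ha1 h₁ hc₂))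

/-! ### The extremal problem for a pair of entries -/

/-- The objective restricted to two entries `t` and `c - t`; `S` and `K` collect the others. -/
def pairObjective (a S K c t : ℝ) : ℝ :=
  log (S + t ^ a + (c - t) ^ a) + (1 - a) * (K + t * log t + (c - t) * log (c - t))

lemma hasDerivAt_pairObjective {a S K c t : ℝ} (hS : 0 ≤ S) (h0 : 0 < t) (h1 : t < c) :
    HasDerivAt (pairObjective a S K c)
      (a * (t ^ (a - 1) - (c - t) ^ (a - 1)) / (S + t ^ a + (c - t) ^ a) +
        (1 - a) * (log t - log (c - t))) t := by
  have h2 : 0 < c - t := sub_pos.2 h1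
  have hsub := (hasDerivAt_id t).const_sub c
  have hZ : 0 < S + t ^ a + (c - t) ^ a := by
    have := rpow_pos_of_pos h0 a; have := rpow_pos_of_pos h2 a; linarith
  have d1 := hasDerivAt_rpow_const (x := t) (p := a) (Or.inl h0.ne')
  have d2 := (hasDerivAt_rpow_const (x := c - t) (p := a) (Or.inl h2.ne')).comp t hsub
  have d3 := hasDerivAt_mul_log h0.ne'
  have d4 := (hasDerivAt_mul_log h2.ne').comp t hsub
  have := (((d1.const_add S).add d2).log hZ.ne').add
    ((((d3.const_add K).add d4)).const_mul (1 - a))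
  convert! this using 1
  simp only [Function.comp, Pi.add_apply]
  ring

lemma eventually_pairObjective_deriv_pos {a S c : ℝ} (ha0 : 0 < a) (ha1 : a ≠ 1) (hS : 0 ≤ S)
    (hc : 0 < c) : ∀ᶠ t in 𝓝[>] (0 : ℝ),
      0 < a * (t ^ (a - 1) - (c - t) ^ (a - 1)) / (S + t ^ a + (c - t) ^ a) +
        (1 - a) * (log t - log (c - t)) := by
  have hZ0 : 0 < S + c ^ a := add_pos_of_nonneg_of_pos hS (rpow_pos_of_pos hc a)
  have hZ : Tendsto (fun t : ℝ => S + t ^ a + (c - t) ^ a) (𝓝[>] 0) (𝓝 (S + c ^ a)) := by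
    have : ContinuousAt (fun t : ℝ => S + t ^ a + (c - t) ^ a) 0 :=
      (continuousAt_const.add (continuousAt_id.rpow_const (Or.inr ha0.le))).add
        (ContinuousAt.rpow_const (by fun_prop) (Or.inr ha0.le))
    have := this.tendsto.mono_left (nhdsWithin_le_nhds (s := Ioi 0))
    simpa [zero_rpow ha0.ne'] using this
  have hP : Tendsto (fun t : ℝ => (c - t) ^ (a - 1)) (𝓝[>] 0) (𝓝 (c ^ (a - 1))) := by
    have : ContinuousAt (fun t : ℝ => (c - t) ^ (a - 1)) 0 :=
      ContinuousAt.rpow_const (by fun_prop) (Or.inl (by simpa using hc.ne'))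
    simpa using this.tendsto.mono_left (nhdsWithin_le_nhds (s := Ioi 0))
  have hl : Tendsto (fun t : ℝ => log (c - t)) (𝓝[>] 0) (𝓝 (log c)) := by
    have : ContinuousAt (fun t : ℝ => log (c - t)) 0 :=
      ContinuousAt.log (by fun_prop) (by simpa using hc.ne')
    simpa using this.tendsto.mono_left (nhdsWithin_le_nhds (s := Ioi 0))
  refine Tendsto.eventually_gt_atTop ?_ 0
  rcases ha1.lt_or_gt with ha1 | ha1
  · have hpow : Tendsto (fun t : ℝ => t ^ (a - 1)) (𝓝[>] 0) atTop :=
      tendsto_rpow_neg_nhdsGT_zero (by linarith)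
    have hsm : Tendsto (fun t : ℝ => t ^ (1 - a)) (𝓝[>] 0) (𝓝 0) := by
      have : ContinuousAt (fun t : ℝ => t ^ (1 - a)) 0 :=
        continuousAt_id.rpow_const (Or.inr (by linarith))
      have := this.tendsto.mono_left (nhdsWithin_le_nhds (s := Ioi 0))
      simpa [zero_rpow (show 1 - a ≠ 0 by linarith)] using this
    have hlg : Tendsto (fun t : ℝ => log t * t ^ (1 - a)) (𝓝[>] 0) (𝓝 0) :=
      tendsto_log_mul_rpow_nhdsGT_zero (by linarith)
    have hbr : Tendsto (fun t : ℝ => a * (1 - t ^ (1 - a) * (c - t) ^ (a - 1)) /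
        (S + t ^ a + (c - t) ^ a) + (1 - a) * (log t * t ^ (1 - a))) (𝓝[>] 0)
        (𝓝 (a / (S + c ^ a))) := by
      have := (((hsm.mul hP).const_sub 1).const_mul a |>.div hZ hZ0.ne').add (hlg.const_mul (1 - a))
      simpa using this
    have := (hpow.atTop_mul_pos (by positivity) hbr).atTop_add (hl.const_mul (-(1 - a)))
    refine this.congr' ?_
    filter_upwards [self_mem_nhdsWithin] with t ht
    have e : t ^ (a - 1) * t ^ (1 - a) = 1 := by
      rw [← rpow_add ht]; simp
    linear_combination (-a * (c - t) ^ (a - 1) / (S + t ^ a + (c - t) ^ a) + (1 - a) * log t) * e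
  · have hsm : Tendsto (fun t : ℝ => t ^ (a - 1)) (𝓝[>] 0) (𝓝 0) := by
      have : ContinuousAt (fun t : ℝ => t ^ (a - 1)) 0 :=
        continuousAt_id.rpow_const (Or.inr (by linarith))
      have := this.tendsto.mono_left (nhdsWithin_le_nhds (s := Ioi 0))
      simpa [zero_rpow (show a - 1 ≠ 0 by linarith)] using this
    have h1 := ((hsm.sub hP).const_mul a).div hZ hZ0.ne'
    have h2 : Tendsto (fun t : ℝ => (1 - a) * (log t - log (c - t))) (𝓝[>] 0) atTop :=
      ((tendsto_log_nhdsGT_zero.atBot_add hl.neg).const_mul_atBot_of_neg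
        (show 1 - a < 0 by linarith)).congr fun t => by ring
    exact h1.add_atTop h2

lemma continuous_pairObjective {a S K c : ℝ} (ha0 : 0 < a) (hS : 0 ≤ S) (hc : 0 < c) :
    ContinuousOn (pairObjective a S K c) (Icc 0 c) := by
  have h1 : Continuous fun t : ℝ => t ^ a := continuous_rpow_const ha0.le
  have h2 := continuous_mul_log
  refine ContinuousOn.add (ContinuousOn.log ?_ ?_) ?_
  · exact ((continuous_const.add h1).add (h1.comp (continuous_const.sub continuous_id))).continuousOn
  · intro t ht
    have i1 := rpow_nonneg ht.1 a
    have i2 := rpow_nonneg (sub_nonneg.2 ht.2) a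
    rcases ht.1.eq_or_lt with h | h
    · rw [← h] at i1 ⊢
      have := rpow_pos_of_pos hc a
      simp only [sub_zero]
      linarith
    · have := rpow_pos_of_pos h a
      linarith
  · exact (continuous_const.mul ((continuous_const.add h2).add
      (h2.comp (continuous_const.sub continuous_id)))).continuousOn

lemma pairObjective_symm (a S K c t : ℝ) :
    pairObjective a S K c (c - t) = pairObjective a S K c t := by
  simp only [pairObjective, sub_sub_cancel]
  rw [show S + (c - t) ^ a + t ^ a = S + t ^ a + (c - t) ^ a by ring]
  ring

lemma exists_pairObjective_zero_lt {a S c : ℝ} (K : ℝ) (ha0 : 0 < a) (ha1 : a ≠ 1) (hS : 0 ≤ S)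
    (hc : 0 < c) : ∃ t ∈ Icc 0 c, pairObjective a S K c 0 < pairObjective a S K c t := by
  obtain ⟨ε, hε, hpos⟩ := mem_nhdsGT_iff_exists_Ioo_subset.1
    (eventually_pairObjective_deriv_pos ha0 ha1 hS hc)
  have hε : 0 < ε := hε
  have hm : 0 < min (ε / 2) c := lt_min (by linarith) hc
  refine ⟨min (ε / 2) c, ⟨hm.le, min_le_right _ _⟩, ?_⟩
  have hmono : StrictMonoOn (pairObjective a S K c) (Icc 0 (min (ε / 2) c)) := by
    refine strictMonoOn_of_hasDerivWithinAt_pos (convex_Icc _ _)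
      ((continuous_pairObjective ha0 hS hc).mono (Icc_subset_Icc_right (min_le_right _ _)))
      (f' := fun t => a * (t ^ (a - 1) - (c - t) ^ (a - 1)) / (S + t ^ a + (c - t) ^ a) +
        (1 - a) * (log t - log (c - t))) ?_ ?_ <;> rw [interior_Icc] <;> intro t ht
    · exact (hasDerivAt_pairObjective hS ht.1 (ht.2.trans_le (min_le_right _ _))).hasDerivWithinAt
    · have := ht.2.trans_le (min_le_left _ _)
      exact hpos ⟨ht.1, by linarith⟩
  exact hmono ⟨le_rfl, hm.le⟩ ⟨hm.le, le_rfl⟩ hm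

lemma pos_of_isMaxOn_pairObjective {a S K c t : ℝ} (ha0 : 0 < a) (ha1 : a ≠ 1) (hS : 0 ≤ S)
    (hc : 0 < c) (ht : t ∈ Icc 0 c) (hmax : IsMaxOn (pairObjective a S K c) (Icc 0 c) t) :
    t ∈ Ioo 0 c := by
  obtain ⟨x, hx, hlt⟩ := exists_pairObjective_zero_lt K ha0 ha1 hS hc
  have hle : pairObjective a S K c x ≤ pairObjective a S K c t := hmax hx
  refine ⟨ht.1.lt_of_ne fun h => ?_, ht.2.lt_of_ne fun h => ?_⟩
  · rw [← h] at hle; linarith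
  · have := pairObjective_symm a S K c t
    rw [h, sub_self] at this
    rw [h] at hle; linarith

lemma not_isLocalMax_of_deriv_deriv_pos {f : ℝ → ℝ} {x : ℝ} (hf : 0 < deriv (deriv f) x)
    (hc : ContinuousAt f x) : ¬ IsLocalMax f x := by
  intro hmax
  have hmin := isLocalMin_of_deriv_deriv_pos hf hmax.deriv_eq_zero hc
  have he : f =ᶠ[𝓝 x] fun _ => f x := by
    filter_upwards [hmax, hmin] with y h1 h2 using le_antisymm h1 h2
  have h1 := he.deriv.deriv_eq
  simp at h1
  linarith

lemma weight_of_isMaxOn_pairObjective {a S K u : ℝ} (hS : 0 ≤ S)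
    (hu : 0 < u) (hmax : IsMaxOn (pairObjective a S K (u + u)) (Icc 0 (u + u)) u) :
    (1 - a) * (1 - a * u ^ (a - 1) / (S + u ^ a + u ^ a)) ≤ 0 := by
  by_contra! hpos
  set c := u + u with hcdef
  have hu2 : c - u = u := by rw [hcdef]; ring
  have hZ : 0 < S + u ^ a + u ^ a := by
    have := rpow_pos_of_pos hu a; linarith
  have hnhds : ∀ᶠ t in 𝓝 u, t ∈ Ioo 0 c := Ioo_mem_nhds hu (by linarith)
  have hd : deriv (pairObjective a S K c) =ᶠ[𝓝 u] fun t =>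
      a * (t ^ (a - 1) - (c - t) ^ (a - 1)) / (S + t ^ a + (c - t) ^ a) +
        (1 - a) * (log t - log (c - t)) := by
    filter_upwards [hnhds] with t ht using (hasDerivAt_pairObjective hS ht.1 ht.2).deriv
  have hsub := (hasDerivAt_id u).const_sub c
  have hu3 : c - u ≠ 0 := by rw [hu2]; exact hu.ne'
  have d1 := hasDerivAt_rpow_const (x := u) (p := a) (Or.inl hu.ne')
  have d2 := (hasDerivAt_rpow_const (x := c - u) (p := a) (Or.inl hu3)).comp u hsub
  have e1 := hasDerivAt_rpow_const (x := u) (p := a - 1) (Or.inl hu.ne')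
  have e2 := (hasDerivAt_rpow_const (x := c - u) (p := a - 1) (Or.inl hu3)).comp u hsub
  have g1 := hasDerivAt_log hu.ne'
  have g2 := (hasDerivAt_log hu3).comp u hsub
  have hdd := (((e1.sub e2).const_mul a).div ((d1.const_add S).add d2)
    (by simp only [Pi.add_apply, Function.comp]; rw [hu2]; exact hZ.ne')).add
      ((g1.sub g2).const_mul (1 - a))
  have hdd' : deriv (deriv (pairObjective a S K c)) u =
      2 / u * ((1 - a) * (1 - a * u ^ (a - 1) / (S + u ^ a + u ^ a))) := by
    rw [hd.deriv_eq]
    refine (hdd.congr_deriv ?_).deriv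
    have e : u ^ (a - 1 - 1) = u ^ (a - 1) / u := by rw [rpow_sub_one hu.ne']
    simp only [Pi.add_apply, Pi.sub_apply, Function.comp, hu2, e]
    field_simp
    ring
  refine not_isLocalMax_of_deriv_deriv_pos (f := pairObjective a S K c) (x := u) ?_
    (hasDerivAt_pairObjective hS hu (by linarith)).continuousAt
    (hmax.isLocalMax (Icc_mem_nhds hu (by linarith)))
  rw [hdd']
  positivity

/-! ### The extremal problem on the simplex -/

/-- A Rényi-type objective: the Legendre-type dual of relative entropy against entropy. -/
def powerObjective {ι : Type*} [Fintype ι] (a : ℝ) (q : ι → ℝ) : ℝ :=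
  log (∑ i, q i ^ a) + (1 - a) * ∑ i, q i * log (q i)

section
variable {ι : Type*} [Fintype ι]

lemma exists_pos_of_mem_stdSimplex {q : ι → ℝ} (hq : q ∈ stdSimplex ℝ ι) : ∃ i, 0 < q i := by
  by_contra! h
  have h2 := Finset.sum_nonpos (s := Finset.univ) (fun i _ => h i)
  linarith [hq.2]

lemma sum_rpow_pos {q : ι → ℝ} (hq : q ∈ stdSimplex ℝ ι) (a : ℝ) : 0 < ∑ i, q i ^ a := by
  obtain ⟨i, hi⟩ := exists_pos_of_mem_stdSimplex hq
  exact Finset.sum_pos' (fun k _ => rpow_nonneg (hq.1 k) a)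
    ⟨i, Finset.mem_univ i, rpow_pos_of_pos hi a⟩

lemma continuousOn_powerObjective {a : ℝ} (ha0 : 0 < a) :
    ContinuousOn (powerObjective a) (stdSimplex ℝ ι) := by
  refine ContinuousOn.add (ContinuousOn.log ?_ fun q hq => (sum_rpow_pos hq a).ne') ?_
  · exact (continuous_finsetSum _ fun i _ =>
      (continuous_rpow_const ha0.le).comp (continuous_apply i)).continuousOn
  · exact (continuous_const.mul (continuous_finsetSum _ fun i _ =>
      continuous_mul_log.comp (continuous_apply i))).continuousOn

lemma rest_rpow_nonneg {q : ι → ℝ} (hq : q ∈ stdSimplex ℝ ι) (a : ℝ) (s : Finset ι) :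
    0 ≤ ∑ k ∈ s, q k ^ a := Finset.sum_nonneg fun k _ => rpow_nonneg (hq.1 k) a

variable [DecidableEq ι]

lemma sum_eq_pair_add (f : ι → ℝ) {i j : ι} (hij : i ≠ j) :
    ∑ k, f k = ∑ k ∈ (Finset.univ.erase i).erase j, f k + f i + f j := by
  rw [← Finset.add_sum_erase Finset.univ f (Finset.mem_univ i),
    ← Finset.add_sum_erase (Finset.univ.erase i) f (a := j) (by simp [hij.symm])]
  ring

/-- Moving mass between two entries of a maximizer reduces to `pairObjective`. -/
lemma isMaxOn_pairObjective {a : ℝ} {q : ι → ℝ} (hq : q ∈ stdSimplex ℝ ι)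
    (hmax : IsMaxOn (powerObjective a) (stdSimplex ℝ ι) q) {i j : ι} (hij : i ≠ j) :
    IsMaxOn (pairObjective a (∑ k ∈ (Finset.univ.erase i).erase j, q k ^ a)
      (∑ k ∈ (Finset.univ.erase i).erase j, q k * log (q k)) (q i + q j))
      (Icc 0 (q i + q j)) (q i) := by
  intro t ht
  let q' : ι → ℝ := fun k => if k = i then t else if k = j then q i + q j - t else q k
  have hi : q' i = t := by simp [q']
  have hj : q' j = q i + q j - t := by simp [q', hij.symm]
  have hother : ∀ k ∈ (Finset.univ.erase i).erase j, q' k = q k := by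
    intro k hk
    simp only [Finset.mem_erase] at hk
    simp [q', hk.1, hk.2.1]
  have hsum : ∀ G : ℝ → ℝ, ∑ k, G (q' k) =
      ∑ k ∈ (Finset.univ.erase i).erase j, G (q k) + G t + G (q i + q j - t) := by
    intro G
    rw [sum_eq_pair_add (fun k => G (q' k)) hij, hi, hj]
    congr 2
    exact Finset.sum_congr rfl fun k hk => by rw [hother k hk]
  have hq' : q' ∈ stdSimplex ℝ ι := by
    refine ⟨fun k => ?_, ?_⟩
    · simp only [q']
      split_ifs
      exacts [ht.1, by linarith [ht.2], hq.1 k]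
    · have := hsum id
      simp only [id] at this
      rw [this, ← hq.2, sum_eq_pair_add q hij]
      ring
  have h := hmax hq'
  simp only [mem_ofPred_eq, powerObjective] at h ⊢
  rw [hsum (fun x => x ^ a), hsum (fun x => x * log x), sum_eq_pair_add (fun k => q k ^ a) hij,
    sum_eq_pair_add (fun k => q k * log (q k)) hij] at h
  simpa [pairObjective] using h

lemma pos_of_isMaxOn_powerObjective {a : ℝ} (ha0 : 0 < a) (ha1 : a ≠ 1) {q : ι → ℝ}
    (hq : q ∈ stdSimplex ℝ ι) (hmax : IsMaxOn (powerObjective a) (stdSimplex ℝ ι) q) (j : ι) :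
    0 < q j := by
  obtain ⟨i, hi⟩ := exists_pos_of_mem_stdSimplex hq
  rcases eq_or_ne i j with rfl | hij
  · exact hi
  have hj := hq.1 j
  have := pos_of_isMaxOn_pairObjective ha0 ha1 (rest_rpow_nonneg hq a _) (by linarith)
    ⟨hi.le, by linarith⟩ (isMaxOn_pairObjective hq hmax hij)
  linarith [this.2]

lemma first_order_powerObjective {a : ℝ} (ha0 : 0 < a) (ha1 : a ≠ 1) {q : ι → ℝ}
    (hq : q ∈ stdSimplex ℝ ι) (hmax : IsMaxOn (powerObjective a) (stdSimplex ℝ ι) q)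
    {i j : ι} (hij : i ≠ j) :
    a * (q i ^ (a - 1) - q j ^ (a - 1)) / (∑ k, q k ^ a) =
      (a - 1) * (log (q i) - log (q j)) := by
  have hi := pos_of_isMaxOn_powerObjective ha0 ha1 hq hmax i
  have hj := pos_of_isMaxOn_powerObjective ha0 ha1 hq hmax j
  have hm := (isMaxOn_pairObjective hq hmax hij).isLocalMax (Icc_mem_nhds hi (by linarith))
  have := hm.hasDerivAt_eq_zero
    (hasDerivAt_pairObjective (rest_rpow_nonneg hq a _) hi (by linarith))
  rw [add_sub_cancel_left] at this
  rw [sum_eq_pair_add (fun k => q k ^ a) hij]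
  linarith

lemma second_order_powerObjective {a : ℝ} (ha0 : 0 < a) (ha1 : a ≠ 1) {q : ι → ℝ}
    (hq : q ∈ stdSimplex ℝ ι) (hmax : IsMaxOn (powerObjective a) (stdSimplex ℝ ι) q)
    {i j : ι} (hij : i ≠ j) (h : q i = q j) :
    (1 - a) * (1 - a * q i ^ (a - 1) / (∑ k, q k ^ a)) ≤ 0 := by
  have hi := pos_of_isMaxOn_powerObjective ha0 ha1 hq hmax i
  have hm := isMaxOn_pairObjective hq hmax hij
  rw [sum_eq_pair_add (fun k => q k ^ a) hij]
  simp only [← h] at hm ⊢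
  exact weight_of_isMaxOn_pairObjective (rest_rpow_nonneg hq a _) hi hm

/-- `x - log x` takes every value at most once on each side of `1`. -/
lemma eq_of_sub_log_eq_of_le_one {x y : ℝ} (hx : 0 < x) (hy : 0 < y) (hx1 : x ≤ 1) (hy1 : y ≤ 1)
    (h : x - log x = y - log y) : x = y := by
  have aux : ∀ x y : ℝ, 0 < x → x < y → y ≤ 1 → y - log y < x - log x := by
    intro x y hx hxy hy1
    have hy : 0 < y := hx.trans hxy
    have h2 := log_lt_sub_one_of_pos (x := x / y) (by positivity) (by
      rw [Ne, div_eq_one_iff_eq hy.ne']; exact hxy.ne)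
    rw [log_div hx.ne' hy.ne'] at h2
    have h3 : x / y - 1 = (x - y) / y := by field_simp
    have h4 : (x - y) / y ≤ x - y := by
      rw [div_le_iff₀ hy]; nlinarith
    linarith
  rcases lt_trichotomy x y with hlt | he | hlt
  · linarith [aux x y hx hlt hy1]
  · exact he
  · linarith [aux y x hy hlt hx1]

lemma eq_of_sub_log_eq_of_one_le {x y : ℝ} (hx1 : 1 ≤ x) (hy1 : 1 ≤ y)
    (h : x - log x = y - log y) : x = y := by
  have aux : ∀ x y : ℝ, 1 ≤ x → x < y → x - log x < y - log y := by
    intro x y hx hxy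
    have hx0 : 0 < x := by linarith
    have hy : 0 < y := by linarith
    have h2 := log_lt_sub_one_of_pos (x := y / x) (by positivity) (by
      rw [Ne, div_eq_one_iff_eq hx0.ne']; exact hxy.ne')
    rw [log_div hy.ne' hx0.ne'] at h2
    have h3 : y / x - 1 = (y - x) / x := by field_simp
    have h4 : (y - x) / x ≤ y - x := by
      rw [div_le_iff₀ hx0]; nlinarith
    linarith
  rcases lt_trichotomy x y with hlt | he | hlt
  · linarith [aux x y hx1 hlt]
  · exact he
  · linarith [aux y x hy1 hlt]

/-- A maximizer of `powerObjective` has one large entry, all others being equal. -/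
lemma exists_two_valued_of_isMaxOn {a : ℝ} (ha0 : 0 < a) (ha1 : a ≠ 1) {q : ι → ℝ}
    (hq : q ∈ stdSimplex ℝ ι) (hmax : IsMaxOn (powerObjective a) (stdSimplex ℝ ι) q) :
    ∃ i, (∀ j, j ≠ i → q j < q i) ∧ ∀ j k, j ≠ i → k ≠ i → q j = q k := by
  have hpos := pos_of_isMaxOn_powerObjective ha0 ha1 hq hmax
  have hZ := sum_rpow_pos hq a
  set Z := ∑ k, q k ^ a with hZdef
  let w : ι → ℝ := fun i => a * q i ^ (a - 1) / Z
  have hw : ∀ i, 0 < w i := fun i => by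
    have := rpow_pos_of_pos (hpos i) (a - 1)
    simp only [w]; positivity
  have hlogw : ∀ i, log (w i) = log a + (a - 1) * log (q i) - log Z := by
    intro i
    have := rpow_pos_of_pos (hpos i) (a - 1)
    simp only [w]
    rw [log_div (by positivity) hZ.ne', log_mul ha0.ne' this.ne', log_rpow (hpos i)]
  have hφ : ∀ i j, w i - log (w i) = w j - log (w j) := by
    intro i j
    rcases eq_or_ne i j with rfl | hij
    · rfl
    have := first_order_powerObjective ha0 ha1 hq hmax hij
    have e : w i - w j = a * (q i ^ (a - 1) - q j ^ (a - 1)) / Z := by simp only [w]; ring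
    rw [← hZdef, ← e] at this
    rw [hlogw, hlogw]; linarith
  have htie : ∀ i j, i ≠ j → q i = q j → (1 - a) * (1 - w i) ≤ 0 :=
    fun i j hij h => second_order_powerObjective ha0 ha1 hq hmax hij h
  have hinj : ∀ i j, w i = w j → q i = q j := by
    intro i j h
    have h1 := hlogw i
    rw [h, hlogw j] at h1
    have h2 : (a - 1) * log (q i) = (a - 1) * log (q j) := by linarith
    exact log_injOn_pos (hpos i) (hpos j) (mul_left_cancel₀ (sub_ne_zero.2 ha1) h2)
  have havg : ∑ i, q i * w i = a := by
    have : ∀ i, q i * w i = a / Z * q i ^ a := by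
      intro i
      have e : q i ^ a = q i * q i ^ (a - 1) := by
        rw [rpow_sub_one (hpos i).ne']; field_simp [(hpos i).ne']
      simp only [w]; rw [e]; ring
    rw [Finset.sum_congr rfl fun i _ => this i, ← Finset.mul_sum, ← hZdef]
    field_simp
  rcases ha1.lt_or_gt with ha1 | ha1
  · obtain ⟨i, hi⟩ : ∃ i, w i < 1 := by
      by_contra! h
      have : ∑ i, q i ≤ ∑ i, q i * w i :=
        Finset.sum_le_sum fun i _ => le_mul_of_one_le_right (hq.1 i) (h i)
      rw [hq.2, havg] at this
      linarith
    have hgt : ∀ j, j ≠ i → 1 < w j := by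
      intro j hj
      by_contra! h
      have := htie i j hj.symm
        (hinj i j (eq_of_sub_log_eq_of_le_one (hw i) (hw j) hi.le h (hφ i j)))
      nlinarith
    refine ⟨i, fun j hj => ?_, fun j k hj hk =>
      hinj j k (eq_of_sub_log_eq_of_one_le (hgt j hj).le (hgt k hk).le (hφ j k))⟩
    have h1 := log_lt_log (hw i) (hi.trans (hgt j hj))
    rw [hlogw, hlogw] at h1
    exact (log_lt_log_iff (hpos j) (hpos i)).1 (by nlinarith)
  · obtain ⟨i, hi⟩ : ∃ i, 1 < w i := by
      by_contra! h
      have : ∑ i, q i * w i ≤ ∑ i, q i :=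
        Finset.sum_le_sum fun i _ => mul_le_of_le_one_right (hq.1 i) (h i)
      rw [hq.2, havg] at this
      linarith
    have hlt : ∀ j, j ≠ i → w j < 1 := by
      intro j hj
      by_contra! h
      have := htie i j hj.symm
        (hinj i j (eq_of_sub_log_eq_of_one_le hi.le h (hφ i j)))
      nlinarith
    refine ⟨i, fun j hj => ?_, fun j k hj hk =>
      hinj j k (eq_of_sub_log_eq_of_le_one (hw j) (hw k) (hlt j hj).le (hlt k hk).le (hφ j k))⟩
    have h1 := log_lt_log (hw j) ((hlt j hj).trans hi)
    rw [hlogw, hlogw] at h1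
    exact (log_lt_log_iff (hpos j) (hpos i)).1 (by nlinarith)

end

lemma powerObjective_le {d : ℕ} (hd : 2 ≤ d) {a ℓ : ℝ} (ha0 : 0 < a) (ha1 : a ≠ 1) (hℓ : 0 < ℓ)
    (hc : IsCritical ((d : ℝ) - 1) a ℓ) {q : Fin d → ℝ} (hq : q ∈ stdSimplex ℝ (Fin d)) :
    powerObjective a q ≤ log ((d : ℝ) - 1 + exp (a * ℓ)) - log ((d : ℝ) - 1 + exp ℓ) +
      (1 - a) * (ℓ * exp ℓ / ((d : ℝ) - 1 + exp ℓ)) := by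
  obtain ⟨p, hp, hmax⟩ := (isCompact_stdSimplex ℝ (Fin d)).exists_isMaxOn ⟨q, hq⟩
    (continuousOn_powerObjective ha0)
  refine (hmax hq).trans (le_of_eq ?_)
  obtain ⟨i, hlt, heq⟩ := exists_two_valued_of_isMaxOn ha0 ha1 hp hmax
  have hd1 : 0 < (d : ℝ) - 1 := by
    have : (2 : ℝ) ≤ d := by exact_mod_cast hd
    linarith
  obtain ⟨j, hj⟩ : ∃ j : Fin d, j ≠ i := by
    have : Nontrivial (Fin d) := Fin.nontrivial_iff_two_le.2 hd
    exact exists_ne i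
  have hpos := pos_of_isMaxOn_powerObjective ha0 ha1 hp hmax
  have hfo := first_order_powerObjective ha0 ha1 hp hmax hj.symm
  have hsum : ∀ G : ℝ → ℝ, ∑ k, G (p k) = G (p i) + ((d : ℝ) - 1) * G (p j) := by
    intro G
    rw [← Finset.add_sum_erase Finset.univ (fun k => G (p k)) (Finset.mem_univ i)]
    congr 1
    rw [Finset.sum_congr rfl (g := fun _ => G (p j)) fun k hk => by
      rw [heq k j (Finset.ne_of_mem_erase hk) hj]]
    rw [Finset.sum_const, Finset.card_erase_of_mem (Finset.mem_univ i), Finset.card_univ,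
      Fintype.card_fin, nsmul_eq_mul, Nat.cast_sub (by omega), Nat.cast_one]
  have hx := hpos i
  have hy := hpos j
  have hxy := hlt j hj
  have h1 := hp.2
  have hs1 := hsum id
  simp only [id] at hs1
  rw [hs1] at h1
  set n := (d : ℝ) - 1
  set x := p i
  set y := p j
  have hell : ∃ m, 0 < m ∧ x = exp m * y ∧ log x - log y = m :=
    ⟨log x - log y, sub_pos.2 (log_lt_log hy hxy), by
      rw [exp_sub, exp_log hx, exp_log hy]; field_simp, rfl⟩
  obtain ⟨m, hm, hxm, hlm⟩ := hell
  have hN : y * (n + exp m) = 1 := by rw [← h1, hxm]; ring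
  have hNpos : 0 < n + exp m := by positivity
  have hya := rpow_pos_of_pos hy a
  have hxa : x ^ a = exp (a * m) * y ^ a := by
    rw [hxm, mul_rpow (exp_pos m).le hy.le, ← exp_mul, mul_comm m a]
  have hxa1 : x ^ (a - 1) = exp ((a - 1) * m) * y ^ (a - 1) := by
    rw [hxm, mul_rpow (exp_pos m).le hy.le, ← exp_mul, mul_comm m (a - 1)]
  have hya1 : y ^ a = y ^ (a - 1) * y := by rw [rpow_sub_one hy.ne']; field_simp
  have hcm : IsCritical n a m := by
    have hy1 := rpow_pos_of_pos hy (a - 1)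
    have hZ : 0 < exp (a * m) * y ^ a + n * y ^ a := by positivity
    rw [hsum (fun z => z ^ a), hxa, hxa1, hlm, div_eq_iff hZ.ne', hya1] at hfo
    have h3 : a * (exp ((a - 1) * m) - 1) = (a - 1) * m * (exp (a * m) + n) * y :=
      mul_left_cancel₀ hy1.ne' (by linear_combination hfo)
    rw [IsCritical]
    linear_combination (-(n + exp m)) * h3 + (1 - a) * m * (n + exp (a * m)) * hN
  obtain rfl := IsCritical.unique hd1 ha0 ha1 hm hℓ hcm hc
  have hlogy : log y = -log (n + exp m) := by
    rw [eq_neg_iff_add_eq_zero, ← log_mul hy.ne' hNpos.ne', hN, log_one]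
  have hyv : y = 1 / (n + exp m) := by rw [← hN]; field_simp
  rw [powerObjective, hsum (fun z => z ^ a), hsum (fun z => z * log z), hxa,
    show exp (a * m) * y ^ a + n * y ^ a = (n + exp (a * m)) * y ^ a by ring,
    log_mul (by positivity) hya.ne', log_rpow hy,
    show log x = m + log y by linarith, hlogy]
  have h5 : m * exp m / (n + exp m) = m * x := by rw [hxm, hyv]; ring
  rw [h5]
  linear_combination (-(1 - a) * log (n + exp m)) * h1

/-! ### Supporting lines -/

section
variable {d : ℕ}

lemma shEntropy_nonneg {p : Fin d → ℝ} (hp : p ∈ stdSimplex ℝ (Fin d)) : 0 ≤ shEntropy p := by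
  refine Finset.sum_nonneg fun i _ => ?_
  have h1 : p i ≤ 1 := hp.2 ▸ Finset.single_le_sum (fun j _ => hp.1 j) (Finset.mem_univ i)
  have := mul_nonpos_of_nonneg_of_nonpos (hp.1 i) (log_nonpos (hp.1 i) h1)
  linarith

lemma sum_mul_log_div {p q : Fin d → ℝ} (hpq : ∀ i, q i = 0 → p i = 0) :
    ∑ i, p i * log (p i / q i) = -shEntropy p - ∑ i, p i * log (q i) := by
  rw [shEntropy, ← Finset.sum_neg_distrib, ← Finset.sum_sub_distrib]
  refine Finset.sum_congr rfl fun i _ => ?_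
  by_cases hi : p i = 0
  · simp [hi]
  · rw [log_div hi fun h => hi (hpq i h)]; ring

/-- Gibbs' inequality against the escort distribution `q ^ a / ∑ q ^ a`. -/
lemma entropy_sub_le_log_sum_rpow {p q : Fin d → ℝ} (hp : p ∈ stdSimplex ℝ (Fin d))
    (hq : q ∈ stdSimplex ℝ (Fin d)) (hpq : ∀ i, q i = 0 → p i = 0) (a : ℝ) :
    (1 - a) * shEntropy p - a * ∑ i, p i * log (p i / q i) ≤ log (∑ i, q i ^ a) := by
  have hZ := sum_rpow_pos hq a
  set Z := ∑ i, q i ^ a with hZdef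
  have hterm : ∀ i, p i - q i ^ a / Z ≤ p i * log (p i) - a * (p i * log (q i)) + p i * log Z := by
    intro i
    have hqa : 0 ≤ q i ^ a := rpow_nonneg (hq.1 i) a
    rcases (hp.1 i).eq_or_lt with h0 | h0
    · simp [← h0]; positivity
    have hqi : 0 < q i := (hq.1 i).lt_of_ne fun h => h0.ne' (hpq i h.symm)
    have hqa : 0 < q i ^ a := rpow_pos_of_pos hqi a
    have := log_le_sub_one_of_pos (x := q i ^ a / Z / p i) (by positivity)
    rw [log_div (by positivity) h0.ne', log_div hqa.ne' hZ.ne', log_rpow hqi] at this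
    have h2 := mul_le_mul_of_nonneg_left this h0.le
    have h3 : p i * (q i ^ a / Z / p i - 1) = q i ^ a / Z - p i := by field_simp
    rw [h3] at h2
    linarith
  have hs := Finset.sum_le_sum fun i (_ : i ∈ Finset.univ) => hterm i
  rw [Finset.sum_sub_distrib, Finset.sum_add_distrib, Finset.sum_sub_distrib, ← Finset.mul_sum,
    ← Finset.sum_mul, ← Finset.sum_div, ← hZdef, hp.2, div_self hZ.ne'] at hs
  rw [sum_mul_log_div hpq]
  have hH : shEntropy p = -∑ i, p i * log (p i) := by rw [shEntropy, Finset.sum_neg_distrib]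
  rw [hH]
  linarith

lemma sum_mul_log_div_nonneg {p q : Fin d → ℝ} (hp : p ∈ stdSimplex ℝ (Fin d))
    (hq : q ∈ stdSimplex ℝ (Fin d)) (hpq : ∀ i, q i = 0 → p i = 0) :
    0 ≤ ∑ i, p i * log (p i / q i) := by
  have := entropy_sub_le_log_sum_rpow hp hq hpq 1
  simp only [rpow_one, hq.2, log_one] at this
  linarith

lemma neg_log_le_sum_mul_log_div {p q : Fin d → ℝ} (hp : p ∈ stdSimplex ℝ (Fin d))
    (hq : q ∈ stdSimplex ℝ (Fin d)) (hpq : ∀ i, q i = 0 → p i = 0) {m : ℝ} (hm : ∀ i, q i ≤ m) :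
    -shEntropy p - log m ≤ ∑ i, p i * log (p i / q i) := by
  rw [sum_mul_log_div hpq]
  have : ∑ i, p i * log (q i) ≤ ∑ i, p i * log m := by
    refine Finset.sum_le_sum fun i _ => ?_
    rcases (hp.1 i).eq_or_lt with h0 | h0
    · simp [← h0]
    have hqi : 0 < q i := (hq.1 i).lt_of_ne fun h => h0.ne' (hpq i h.symm)
    exact mul_le_mul_of_nonneg_left (log_le_log hqi (hm i)) h0.le
  rw [← Finset.sum_mul, hp.2] at this
  linarith

/-- Fano's inequality, in tangent form. -/
lemma shEntropy_le_tangent (hd : 2 ≤ d) {q : Fin d → ℝ} (hq : q ∈ stdSimplex ℝ (Fin d))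
    (i : Fin d) {r : ℝ} (h0 : 0 < r) (h1 : r < 1) :
    shEntropy q ≤ qaryEntropy d r + entropySlope d r * (1 - q i - r) := by
  have hd1 : 0 < (d : ℝ) - 1 := by
    have : (2 : ℝ) ≤ d := by exact_mod_cast hd
    linarith
  have hr1 : 0 < 1 - r := by linarith
  have hterm : ∀ x t : ℝ, 0 ≤ x → 0 < t → -(x * log x) ≤ -(x * log t) + (t - x) := by
    intro x t hx ht
    rcases hx.eq_or_lt with h | h
    · simp [← h, ht.le]
    have := log_le_sub_one_of_pos (x := t / x) (by positivity)
    rw [log_div ht.ne' h.ne'] at this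
    have h2 := mul_le_mul_of_nonneg_left this h.le
    have h3 : x * (t / x - 1) = t - x := by field_simp
    linarith
  have hcard : ((Finset.univ.erase i).card : ℝ) = (d : ℝ) - 1 := by
    rw [Finset.card_erase_of_mem (Finset.mem_univ i), Finset.card_univ, Fintype.card_fin,
      Nat.cast_sub (by omega), Nat.cast_one]
  have hrest : ∑ j ∈ Finset.univ.erase i, q j = 1 - q i := by
    rw [← hq.2, ← Finset.add_sum_erase _ _ (Finset.mem_univ i)]; ring
  have hi := hterm (q i) (1 - r) (hq.1 i) hr1
  have hj := Finset.sum_le_sum fun j (_ : j ∈ Finset.univ.erase i) =>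
    hterm (q j) (r / ((d : ℝ) - 1)) (hq.1 j) (by positivity)
  rw [Finset.sum_add_distrib, Finset.sum_neg_distrib, Finset.sum_neg_distrib, ← Finset.sum_mul,
    Finset.sum_sub_distrib, Finset.sum_const, nsmul_eq_mul, hcard, hrest,
    mul_div_cancel₀ _ hd1.ne', log_div h0.ne' hd1.ne', ← Finset.sum_neg_distrib] at hj
  rw [shEntropy, ← Finset.add_sum_erase _ _ (Finset.mem_univ i)]
  refine (add_le_add hi hj).trans (le_of_eq ?_)
  simp [qaryEntropy, binEntropy, entropySlope]
  ring

lemma qaryEntropy_range_bound (hd : 2 ≤ d) : qaryEntropy d (((d : ℝ) - 1) / d) = log d := by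
  have hd2 : (2 : ℝ) ≤ d := by exact_mod_cast hd
  have e : 1 - ((d : ℝ) - 1) / d = 1 / d := by field_simp; ring
  simp only [qaryEntropy, binEntropy, e, log_inv]
  rw [log_div (by linarith) (by linarith), one_div, log_inv]
  push_cast
  field_simp
  ring

lemma entropySlope_range_bound (hd : 2 ≤ d) : entropySlope d (((d : ℝ) - 1) / d) = 0 := by
  have hd2 : (2 : ℝ) ≤ d := by exact_mod_cast hd
  have e : 1 - ((d : ℝ) - 1) / d = 1 / d := by field_simp; ring
  rw [entropySlope, e, one_div, log_inv, log_div (by linarith) (by linarith)]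
  ring

lemma shEntropy_le_log (hd : 2 ≤ d) {q : Fin d → ℝ} (hq : q ∈ stdSimplex ℝ (Fin d)) :
    shEntropy q ≤ log d := by
  have := shEntropy_le_tangent hd hq ⟨0, by omega⟩ (range_bound_pos hd) (range_bound_lt_one hd)
  rwa [entropySlope_range_bound hd, zero_mul, add_zero, qaryEntropy_range_bound hd] at this

/-- `D₂(s‖r)` is attained on a line supporting the set of pairs (entropy change, divergence). -/
def IsSupporting (d : ℕ) (s r slope : ℝ) : Prop :=
  ∀ p ∈ stdSimplex ℝ (Fin d), ∀ q ∈ stdSimplex ℝ (Fin d), (∀ i, q i = 0 → p i = 0) →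
    binKL s r + slope * (shEntropy p - shEntropy q - (qaryEntropy d s - qaryEntropy d r)) ≤
      ∑ i, p i * log (p i / q i)

lemma exp_entropySlope (hd : 2 ≤ d) {r : ℝ} (h0 : 0 < r) (h1 : r < 1) :
    exp (entropySlope d r) = ((d : ℝ) - 1) * (1 - r) / r := by
  have hd1 : 0 < (d : ℝ) - 1 := by
    have : (2 : ℝ) ≤ d := by exact_mod_cast hd
    linarith
  rw [entropySlope, exp_sub, exp_add, exp_log hd1, exp_log (by linarith), exp_log h0]

lemma isSupporting_of_critical (hd : 2 ≤ d) {s r : ℝ} (hs0 : 0 < s)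
    (hs1 : s < ((d : ℝ) - 1) / d) (hr0 : 0 < r) (hr1 : r < ((d : ℝ) - 1) / d) (hsr : s ≠ r)
    (hE : r * (1 - r) * entropySlope d r * (entropySlope d r - entropySlope d s) =
      (s - r) * entropySlope d s) :
    ∃ slope, IsSupporting d s r slope := by
  have hd1 : 0 < (d : ℝ) - 1 := by
    have : (2 : ℝ) ≤ d := by exact_mod_cast hd
    linarith
  have hb := range_bound_lt_one hd
  have hs1' : s < 1 := hs1.trans hb
  have hr1' : r < 1 := hr1.trans hb
  have hℓ := entropySlope_pos hd hr0 hr1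
  have hb0 := entropySlope_pos hd hs0 hs1
  have er := exp_entropySlope hd hr0 hr1'
  have es := exp_entropySlope hd hs0 hs1'
  have hhr : qaryEntropy d r = log ((d : ℝ) - 1) - log r - entropySlope d r * (1 - r) := by
    simp [qaryEntropy, binEntropy, entropySlope]; ring
  have hhs : qaryEntropy d s = log ((d : ℝ) - 1) - log s - entropySlope d s * (1 - s) := by
    simp [qaryEntropy, binEntropy, entropySlope]; ring
  have hkl := binKL_eq (d := d) hs1' hr0 hr1'
  set ℓ := entropySlope d r
  set b := entropySlope d s
  set n := (d : ℝ) - 1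
  obtain ⟨a, hab⟩ : ∃ a, b = a * ℓ := ⟨b / ℓ, by field_simp⟩
  have ha0 : 0 < a := pos_of_mul_pos_left (hab ▸ hb0) hℓ.le
  have ha1 : a ≠ 1 := by
    rintro rfl
    rw [one_mul] at hab
    rw [hab] at hE
    have : (s - r) * ℓ = 0 := by rw [← hE]; ring
    rcases mul_eq_zero.1 this with h | h
    · exact hsr (sub_eq_zero.1 h)
    · exact hℓ.ne' h
  have hc : IsCritical n a ℓ := by
    rw [IsCritical, show (a - 1) * ℓ = b - ℓ by rw [hab]; ring, exp_sub, ← hab, er, es]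
    have h1 : 1 - r ≠ 0 := by linarith
    rw [hab] at hE
    have hE' : r * (1 - r) * ℓ * (1 - a) = (s - r) * a :=
      mul_right_cancel₀ hℓ.ne' (by linear_combination hE)
    field_simp
    linear_combination (-1) * hE'
  refine ⟨(1 - a) / a, fun p hp q hq hpq => ?_⟩
  have h1 := entropy_sub_le_log_sum_rpow hp hq hpq a
  have h2 := powerObjective_le hd ha0 ha1 hℓ hc hq
  have hn1 : n + exp ℓ = n / r := by rw [er]; field_simp; ring
  have hn2 : n + exp (a * ℓ) = n / s := by rw [← hab, es]; field_simp; ring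
  have hq2 : ∑ i, q i * log (q i) = -shEntropy q := by
    rw [shEntropy, Finset.sum_neg_distrib, neg_neg]
  have h3 : ℓ * exp ℓ / (n / r) = ℓ * (1 - r) := by rw [er]; field_simp
  rw [powerObjective, hn1, hn2, h3, hq2, log_div hd1.ne' hs0.ne', log_div hd1.ne' hr0.ne'] at h2
  refine le_of_mul_le_mul_left ?_ ha0
  have h4 : a * ((1 - a) / a * (shEntropy p - shEntropy q - (qaryEntropy d s - qaryEntropy d r))) =
      (1 - a) * (shEntropy p - shEntropy q - (qaryEntropy d s - qaryEntropy d r)) := by field_simp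
  rw [mul_add, h4, hkl, hhr, hhs, hab]
  linarith

lemma exists_le_max (hd : 2 ≤ d) (q : Fin d → ℝ) : ∃ i, ∀ j, q j ≤ q i := by
  have : Nonempty (Fin d) := ⟨⟨0, by omega⟩⟩
  exact Finite.exists_max q

lemma isSupporting_zero (hd : 2 ≤ d) {r : ℝ} (hr0 : 0 < r) (hr1 : r < ((d : ℝ) - 1) / d)
    (hL : (1 - r) * entropySlope d r ≤ 1) :
    IsSupporting d 0 r (-((1 - r) * entropySlope d r)⁻¹) := by
  intro p hp q hq hpq
  have hr1' : r < 1 := hr1.trans (range_bound_lt_one hd)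
  have h1r : 0 < 1 - r := by linarith
  have hℓ := entropySlope_pos hd hr0 hr1
  obtain ⟨i, hi⟩ := exists_le_max hd q
  have hm : 0 < q i := by
    obtain ⟨j, hj⟩ := exists_pos_of_mem_stdSimplex hq
    exact hj.trans_le (hi j)
  have h1 := neg_log_le_sum_mul_log_div hp hq hpq hi
  have h2 := shEntropy_le_tangent hd hq i hr0 hr1'
  have h3 := shEntropy_nonneg hp
  have h4 := log_le_sub_one_of_pos (x := q i / (1 - r)) (by positivity)
  rw [log_div hm.ne' h1r.ne'] at h4
  have hkl : binKL 0 r = -log (1 - r) := by simp [binKL]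
  rw [hkl, qaryEntropy_zero]
  set ℓ := entropySlope d r
  have hμ : 1 ≤ ((1 - r) * ℓ)⁻¹ := (one_le_inv₀ (by positivity)).2 hL
  have h5 : ((1 - r) * ℓ)⁻¹ * (shEntropy q - qaryEntropy d r) ≤ 1 - q i / (1 - r) := by
    have : ((1 - r) * ℓ)⁻¹ * (shEntropy q - qaryEntropy d r) ≤
        ((1 - r) * ℓ)⁻¹ * (ℓ * (1 - q i - r)) := by gcongr; linarith
    refine this.trans (le_of_eq ?_)
    field_simp
    ring
  have h6 := mul_le_mul_of_nonneg_right hμ h3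
  linarith

end

/-! ### Existence of supporting lines -/

lemma StrictMonoOn.exists_continuous_inverse {f : ℝ → ℝ} {a b : ℝ} (hab : a ≤ b)
    (hf : StrictMonoOn f (Icc a b)) (hc : ContinuousOn f (Icc a b)) :
    ∃ g : ℝ → ℝ, Continuous g ∧ ∀ y ∈ Icc (f a) (f b), g y ∈ Icc a b ∧ f (g y) = y := by
  have hle : f a ≤ f b := hf.monotoneOn ⟨le_rfl, hab⟩ ⟨hab, le_rfl⟩ hab
  have hmap : MapsTo f (Icc a b) (Icc (f a) (f b)) := fun x hx =>
    ⟨hf.monotoneOn ⟨le_rfl, hab⟩ hx hx.1, hf.monotoneOn hx ⟨hab, le_rfl⟩ hx.2⟩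
  let F : Icc a b → Icc (f a) (f b) := hmap.restrict f _ _
  have hF : Continuous F := hc.mapsToRestrict hmap
  have hbij : Function.Bijective F := by
    refine ⟨fun x y h => Subtype.ext (hf.injOn x.2 y.2 (congrArg Subtype.val h)), fun y => ?_⟩
    obtain ⟨x, hx, hxy⟩ := intermediate_value_Icc hab hc y.2
    exact ⟨⟨x, hx⟩, Subtype.ext hxy⟩
  let e := Continuous.homeoOfEquivCompactToT2 (f := Equiv.ofBijective F hbij) hF
  refine ⟨Set.IccExtend hle fun y => (e.symm y : ℝ),
    (continuous_subtype_val.comp e.symm.continuous).Icc_extend', fun y hy => ?_⟩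
  rw [Set.IccExtend_of_mem hle _ hy]
  exact ⟨(e.symm ⟨y, hy⟩).2, congrArg Subtype.val (e.apply_symm_apply ⟨y, hy⟩)⟩

lemma continuousOn_sqrt_mul_entropySlope (d : ℕ) :
    ContinuousOn (fun r => √r * entropySlope d r) (Ico 0 1) := by
  have h : ContinuousOn (fun r => √r * (log ((d : ℝ) - 1) + log (1 - r)) - 2 * (√r * log √r))
      (Ico 0 1) := by
    refine ContinuousOn.sub (ContinuousOn.mul (by fun_prop)
      (continuousOn_const.add (ContinuousOn.log (by fun_prop) fun r hr => ?_))) ?_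
    · linarith [hr.2]
    · exact (continuous_const.mul (continuous_mul_log.comp continuous_sqrt)).continuousOn
  refine h.congr fun r hr => ?_
  simp only [entropySlope, log_sqrt hr.1]
  ring

lemma continuousOn_entropySlope (d : ℕ) : ContinuousOn (entropySlope d) (Ioo 0 1) := by
  refine (continuousOn_const.add (ContinuousOn.log (by fun_prop) fun r hr => ?_)).sub
    (ContinuousOn.log (by fun_prop) fun r hr => hr.1.ne')
  linarith [hr.2]

/-- The reciprocal slope extends continuously by zero at the origin. -/
lemma continuousOn_inv_entropySlope {d : ℕ} (hd : 2 ≤ d) :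
    ContinuousOn (Function.update (fun s => (entropySlope d s)⁻¹) 0 0)
      (Ico 0 (((d : ℝ) - 1) / d)) := by
  have hb := range_bound_lt_one hd
  intro s hs
  rcases hs.1.eq_or_lt with h | h
  · rw [← h, continuousWithinAt_update_same]
    refine Tendsto.inv_tendsto_atTop ?_
    have h1 : Tendsto (fun s : ℝ => log ((d : ℝ) - 1) + log (1 - s)) (𝓝[>] 0)
        (𝓝 (log ((d : ℝ) - 1) + log 1)) := by
      have : ContinuousAt (fun s : ℝ => log ((d : ℝ) - 1) + log (1 - s)) 0 :=
        continuousAt_const.add (ContinuousAt.log (by fun_prop) (by simp))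
      simpa using this.tendsto.mono_left (nhdsWithin_le_nhds (s := Ioi 0))
    have h2 := h1.add_atTop (tendsto_neg_atBot_atTop.comp tendsto_log_nhdsGT_zero)
    refine (h2.congr fun s => ?_).mono_left (nhdsWithin_mono _ ?_)
    · simp only [entropySlope, Function.comp]; ring
    · rintro x ⟨hx, hx0⟩
      exact hx.1.lt_of_ne fun h => hx0 h.symm
  · have : ContinuousAt (fun s => (entropySlope d s)⁻¹) s :=
      ((continuousOn_entropySlope d).continuousAt (Ioo_mem_nhds h (hs.2.trans hb))).inv₀
        (entropySlope_pos hd h hs.2).ne'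
    exact ((continuousAt_update_of_ne h.ne').2 this).continuousWithinAt

/-- A continuous inverse of the `d`-ary entropy on its increasing branch. -/
lemma exists_qaryEntropy_inverse {d : ℕ} (hd : 2 ≤ d) : ∃ g : ℝ → ℝ, Continuous g ∧
    (∀ y ∈ Icc 0 (log d), g y ∈ Icc 0 (((d : ℝ) - 1) / d) ∧ qaryEntropy d (g y) = y) ∧
    (∀ y ∈ Icc 0 (log d), 0 < y → 0 < g y) ∧
    (∀ y ∈ Icc 0 (log d), y < log d → g y < ((d : ℝ) - 1) / d) ∧
    g 0 = 0 ∧ g (log d) = ((d : ℝ) - 1) / d := by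
  have hb := range_bound_pos hd
  have hmono : StrictMonoOn (qaryEntropy d) (Icc 0 (((d : ℝ) - 1) / d)) := by
    rw [range_bound_eq hd]; exact qaryEntropy_strictMonoOn hd
  obtain ⟨g, hg, hinv⟩ := hmono.exists_continuous_inverse hb.le qaryEntropy_continuous.continuousOn
  rw [qaryEntropy_zero, qaryEntropy_range_bound hd] at hinv
  have hlog : 0 ≤ log (d : ℝ) := log_natCast_nonneg d
  refine ⟨g, hg, hinv, fun y hy h => ?_, fun y hy h => ?_, ?_, ?_⟩
  · refine (hinv y hy).1.1.lt_of_ne fun h0 => ?_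
    have := (hinv y hy).2
    rw [← h0, qaryEntropy_zero] at this
    exact h.ne this
  · refine (hinv y hy).1.2.lt_of_ne fun h0 => ?_
    have := (hinv y hy).2
    rw [h0, qaryEntropy_range_bound hd] at this
    exact h.ne' this
  · have := hinv 0 ⟨le_rfl, hlog⟩
    exact hmono.injOn this.1 ⟨le_rfl, hb.le⟩ (by rw [this.2, qaryEntropy_zero])
  · have := hinv (log d) ⟨hlog, le_rfl⟩
    exact hmono.injOn this.1 ⟨hb.le, le_rfl⟩ (by rw [this.2, qaryEntropy_range_bound hd])

lemma exists_isSupporting_of_pos {d : ℕ} (hd : 2 ≤ d) {Δ : ℝ} (h0 : 0 < Δ) (h1 : Δ < log d) :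
    ∃ s r slope, s ∈ Icc 0 (((d : ℝ) - 1) / d) ∧ r ∈ Icc 0 (((d : ℝ) - 1) / d) ∧ 0 < r ∧
      qaryEntropy d s - qaryEntropy d r = Δ ∧ IsSupporting d s r slope := by
  obtain ⟨g, hg, hinv, hpos, hlt, hg0, hg1⟩ := exists_qaryEntropy_inverse hd
  have hb := range_bound_lt_one hd
  let E : ℝ → ℝ := fun v =>
    (1 - g v) * (√(g v) * entropySlope d (g v)) ^ 2 -
      (1 - g v) * √(g v) * (√(g v) * entropySlope d (g v)) * entropySlope d (g (v + Δ)) -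
      (g (v + Δ) - g v) * entropySlope d (g (v + Δ))
  have hr : ∀ v ∈ Icc 0 (log d - Δ), v ∈ Icc 0 (log d) ∧ v < log d := fun v hv =>
    ⟨⟨hv.1, by linarith [hv.2]⟩, by linarith [hv.2]⟩
  have hs : ∀ v ∈ Icc 0 (log d - Δ), v + Δ ∈ Icc 0 (log d) ∧ 0 < v + Δ := fun v hv =>
    ⟨⟨by linarith [hv.1], by linarith [hv.2]⟩, by linarith [hv.1]⟩
  have hE : ContinuousOn E (Icc 0 (log d - Δ)) := by
    have cr : ContinuousOn g (Icc 0 (log d - Δ)) := hg.continuousOn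
    have cs : ContinuousOn (fun v => g (v + Δ)) (Icc 0 (log d - Δ)) := by fun_prop
    have cG : ContinuousOn (fun v => √(g v) * entropySlope d (g v)) (Icc 0 (log d - Δ)) :=
      (continuousOn_sqrt_mul_entropySlope d).comp cr fun v hv =>
        ⟨(hinv v (hr v hv).1).1.1, (hinv v (hr v hv).1).1.2.trans_lt hb⟩
    have cL : ContinuousOn (fun v => entropySlope d (g (v + Δ))) (Icc 0 (log d - Δ)) :=
      (continuousOn_entropySlope d).comp cs fun v hv =>
        ⟨hpos _ (hs v hv).1 (hs v hv).2, (hinv _ (hs v hv).1).1.2.trans_lt hb⟩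
    have c1 : ContinuousOn (fun v => 1 - g v) (Icc 0 (log d - Δ)) := by fun_prop
    have c2 : ContinuousOn (fun v => √(g v)) (Icc 0 (log d - Δ)) := by fun_prop
    exact ((c1.mul (cG.pow 2)).sub (((c1.mul c2).mul cG).mul cL)).sub ((cs.sub cr).mul cL)
  have hE0 : E 0 < 0 := by
    have hΔ : Δ ∈ Icc 0 (log d) := ⟨h0.le, h1.le⟩
    have := mul_pos (hpos Δ hΔ h0) (entropySlope_pos hd (hpos Δ hΔ h0) (hlt Δ hΔ h1))
    simp only [E, hg0, zero_add, sqrt_zero]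
    linarith
  have hE1 : 0 < E (log d - Δ) := by
    have hv : log d - Δ ∈ Icc 0 (log d) := ⟨by linarith, by linarith⟩
    have hp := hpos _ hv (by linarith)
    have hl := hlt _ hv (by linarith)
    have hL := entropySlope_pos hd hp hl
    have h1r : 0 < 1 - g (log d - Δ) := by linarith
    simp only [E, sub_add_cancel, hg1, entropySlope_range_bound hd]
    have := sqrt_pos.2 hp
    have : 0 < (1 - g (log d - Δ)) * (√(g (log d - Δ)) * entropySlope d (g (log d - Δ))) ^ 2 := by
      positivity
    linarith
  obtain ⟨v, hv, hv0⟩ := intermediate_value_Ioo (by linarith) hE ⟨hE0, hE1⟩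
  have hv' := Ioo_subset_Icc_self hv
  obtain ⟨hrI, hr2⟩ := hr v hv'
  obtain ⟨hsI, hs2⟩ := hs v hv'
  have hr0 := hpos v hrI hv.1
  have hh : qaryEntropy d (g (v + Δ)) - qaryEntropy d (g v) = Δ := by
    rw [(hinv _ hrI).2, (hinv _ hsI).2]; ring
  have hsq := mul_self_sqrt hr0.le
  obtain ⟨slope, hsl⟩ := isSupporting_of_critical hd (hpos _ hsI hs2)
    (hlt _ hsI (by linarith [hv.2])) hr0 (hlt _ hrI hr2)
    (fun h => by rw [h, sub_self] at hh; exact h0.ne hh) (by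
      simp only [E] at hv0
      linear_combination hv0 - (1 - g v) * entropySlope d (g v) *
        (entropySlope d (g v) - entropySlope d (g (v + Δ))) * hsq)
  exact ⟨_, _, slope, (hinv _ hsI).1, (hinv _ hrI).1, hr0, hh, hsl⟩

lemma exists_isSupporting_of_neg {d : ℕ} (hd : 2 ≤ d) {δ : ℝ} (h0 : 0 < δ) (h1 : δ < log d) :
    ∃ s r slope, s ∈ Icc 0 (((d : ℝ) - 1) / d) ∧ r ∈ Icc 0 (((d : ℝ) - 1) / d) ∧ 0 < r ∧
      qaryEntropy d s - qaryEntropy d r = -δ ∧ IsSupporting d s r slope := by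
  obtain ⟨g, hg, hinv, hpos, hlt, hg0, hg1⟩ := exists_qaryEntropy_inverse hd
  have hb := range_bound_lt_one hd
  have hδI : δ ∈ Icc 0 (log d) := ⟨h0.le, h1.le⟩
  have hδ0 := hpos δ hδI h0
  have hδ1 := hlt δ hδI h1
  rcases le_or_gt ((1 - g δ) * entropySlope d (g δ)) 1 with hL | hL
  · exact ⟨0, g δ, _, ⟨le_rfl, (range_bound_pos hd).le⟩, (hinv δ hδI).1, hδ0, by
      rw [(hinv δ hδI).2, qaryEntropy_zero, zero_sub], isSupporting_zero hd hδ0 hδ1 hL⟩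
  let c : ℝ → ℝ := Function.update (fun s => (entropySlope d s)⁻¹) 0 0
  let E : ℝ → ℝ := fun v =>
    g v * (1 - g v) * entropySlope d (g v) * (entropySlope d (g v) * c (g (v - δ)) - 1) +
      (g v - g (v - δ))
  have hr : ∀ v ∈ Icc δ (log d), v ∈ Icc 0 (log d) ∧ 0 < v := fun v hv =>
    ⟨⟨by linarith [hv.1], hv.2⟩, by linarith [hv.1]⟩
  have hs : ∀ v ∈ Icc δ (log d), v - δ ∈ Icc 0 (log d) ∧ v - δ < log d := fun v hv =>
    ⟨⟨by linarith [hv.1], by linarith [hv.2]⟩, by linarith [hv.2]⟩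
  have hE : ContinuousOn E (Icc δ (log d)) := by
    have cr : ContinuousOn g (Icc δ (log d)) := hg.continuousOn
    have cs : ContinuousOn (fun v => g (v - δ)) (Icc δ (log d)) := by fun_prop
    have cL : ContinuousOn (fun v => entropySlope d (g v)) (Icc δ (log d)) :=
      (continuousOn_entropySlope d).comp cr fun v hv =>
        ⟨hpos _ (hr v hv).1 (hr v hv).2, (hinv _ (hr v hv).1).1.2.trans_lt hb⟩
    have cc : ContinuousOn (fun v => c (g (v - δ))) (Icc δ (log d)) :=
      (continuousOn_inv_entropySlope hd).comp cs fun v hv =>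
        ⟨(hinv _ (hs v hv).1).1.1, hlt _ (hs v hv).1 (hs v hv).2⟩
    exact (((cr.mul (continuousOn_const.sub cr)).mul cL).mul
      ((cL.mul cc).sub continuousOn_const)).add (cr.sub cs)
  have hE0 : E δ < 0 := by
    simp only [E, sub_self, hg0, c, Function.update_self]
    nlinarith
  have hE1 : 0 < E (log d) := by
    have := hlt (log d - δ) ⟨by linarith, by linarith⟩ (by linarith)
    simp only [E, hg1, entropySlope_range_bound hd]
    linarith
  obtain ⟨v, hv, hv0⟩ := intermediate_value_Ioo h1.le hE ⟨hE0, hE1⟩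
  have hv' := Ioo_subset_Icc_self hv
  obtain ⟨hrI, hr2⟩ := hr v hv'
  obtain ⟨hsI, hs2⟩ := hs v hv'
  have hr0 := hpos v hrI hr2
  have hs0 := hpos _ hsI (by linarith [hv.1])
  have hs1 := hlt _ hsI hs2
  have hh : qaryEntropy d (g (v - δ)) - qaryEntropy d (g v) = -δ := by
    rw [(hinv _ hrI).2, (hinv _ hsI).2]; ring
  have hc : c (g (v - δ)) * entropySlope d (g (v - δ)) = 1 := by
    simp only [c, Function.update_of_ne hs0.ne']
    exact inv_mul_cancel₀ (entropySlope_pos hd hs0 hs1).ne'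
  obtain ⟨slope, hsl⟩ := isSupporting_of_critical hd hs0 hs1 hr0 (hlt _ hrI hv.2)
    (fun h => by rw [h, sub_self] at hh; linarith) (by
      simp only [E] at hv0
      linear_combination entropySlope d (g (v - δ)) * hv0 -
        g v * (1 - g v) * entropySlope d (g v) ^ 2 * hc)
  exact ⟨_, _, slope, (hinv _ hsI).1, (hinv _ hrI).1, hr0, hh, hsl⟩

/-! ### The stepwise bound -/

section
variable {d : ℕ}

lemma Mfun_le_ofReal_binKL (hd : 2 ≤ d) {s r : ℝ} (hs : s ∈ Icc 0 (((d : ℝ) - 1) / d))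
    (hr : r ∈ Icc 0 (((d : ℝ) - 1) / d)) (h0 : 0 < r) :
    Mfun (qaryEntropy d s - qaryEntropy d r) d ≤ ENNReal.ofReal (binKL s r) :=
  sInf_le ⟨s, r, hs, hr, binEntropy'_constraint s r,
    (binRelEntropy_eq_ofReal h0 (hr.2.trans_lt (range_bound_lt_one hd))).symm⟩

lemma Mfun_zero (hd : 2 ≤ d) : Mfun 0 d = 0 := by
  have hb := (range_bound_pos hd).le
  exact le_antisymm (sInf_le ⟨0, 0, ⟨le_rfl, hb⟩, ⟨le_rfl, hb⟩, by simp, by simp [binRelEntropy]⟩)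
    zero_le

lemma mul_Mfun_le_sum_of_isSupporting (hd : 2 ≤ d) {k : ℕ} {ρ : ℕ → Fin d → ℝ}
    (hρ : ∀ j ≤ k, ρ j ∈ stdSimplex ℝ (Fin d)) {s r slope : ℝ}
    (hs : s ∈ Icc 0 (((d : ℝ) - 1) / d)) (hr : r ∈ Icc 0 (((d : ℝ) - 1) / d)) (h0 : 0 < r)
    (hΔ : k * (qaryEntropy d s - qaryEntropy d r) = shEntropy (ρ 0) - shEntropy (ρ k))
    (hsup : IsSupporting d s r slope) :
    k * Mfun (qaryEntropy d s - qaryEntropy d r) d ≤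
      ∑ j ∈ Finset.range k, relEntropy (ρ j) (ρ (j + 1)) := by
  by_cases hfin : ∀ j ∈ Finset.range k, ∀ i, ρ (j + 1) i = 0 → ρ j i = 0
  swap
  · push Not at hfin
    obtain ⟨j, hj, i, hi, hi'⟩ := hfin
    have : relEntropy (ρ j) (ρ (j + 1)) = ⊤ := if_neg fun h => hi' (h i hi)
    rw [ENNReal.sum_eq_top.2 ⟨j, hj, this⟩]
    exact le_top
  have hmem : ∀ j ∈ Finset.range k, ρ j ∈ stdSimplex ℝ (Fin d) ∧
      ρ (j + 1) ∈ stdSimplex ℝ (Fin d) := fun j hj =>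
    ⟨hρ j (Finset.mem_range.1 hj).le, hρ (j + 1) (Finset.mem_range.1 hj)⟩
  have hsum : k * binKL s r ≤
      ∑ j ∈ Finset.range k, ∑ i, ρ j i * log (ρ j i / ρ (j + 1) i) := by
    refine le_trans (le_of_eq ?_) (Finset.sum_le_sum fun j hj =>
      hsup _ (hmem j hj).1 _ (hmem j hj).2 (hfin j hj))
    rw [Finset.sum_add_distrib, ← Finset.mul_sum, Finset.sum_sub_distrib,
      Finset.sum_range_sub' (fun j => shEntropy (ρ j)), Finset.sum_const, Finset.sum_const,
      Finset.card_range, nsmul_eq_mul, nsmul_eq_mul, hΔ]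
    ring
  calc k * Mfun (qaryEntropy d s - qaryEntropy d r) d
      ≤ k * ENNReal.ofReal (binKL s r) := by gcongr; exact Mfun_le_ofReal_binKL hd hs hr h0
    _ = ENNReal.ofReal (k * binKL s r) := by
      rw [ENNReal.ofReal_mul (Nat.cast_nonneg k), ENNReal.ofReal_natCast]
    _ ≤ ENNReal.ofReal (∑ j ∈ Finset.range k, ∑ i, ρ j i * log (ρ j i / ρ (j + 1) i)) :=
      ENNReal.ofReal_le_ofReal hsum
    _ = ∑ j ∈ Finset.range k, relEntropy (ρ j) (ρ (j + 1)) := by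
      rw [ENNReal.ofReal_sum_of_nonneg fun j hj =>
        sum_mul_log_div_nonneg (hmem j hj).1 (hmem j hj).2 (hfin j hj)]
      exact Finset.sum_congr rfl fun j hj => (if_pos (hfin j hj)).symm

lemma relEntropy_eq_top {p q : Fin d → ℝ} (hp : p ∈ stdSimplex ℝ (Fin d))
    (hq : q ∈ stdSimplex ℝ (Fin d)) (hHp : 0 < shEntropy p) (hHq : shEntropy q = 0) :
    relEntropy p q = ⊤ := by
  refine if_neg fun hpq => hHp.ne' ?_
  have hle : ∀ {q : Fin d → ℝ}, q ∈ stdSimplex ℝ (Fin d) → ∀ i, q i ≤ 1 := fun hq i =>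
    hq.2 ▸ Finset.single_le_sum (fun j _ => hq.1 j) (Finset.mem_univ i)
  have hnn : ∀ i, 0 ≤ -(q i * log (q i)) := fun i => by
    have := mul_nonpos_of_nonneg_of_nonpos (hq.1 i) (log_nonpos (hq.1 i) (hle hq i))
    linarith
  have hz := (Finset.sum_eq_zero_iff_of_nonneg fun i _ => hnn i).1 hHq
  obtain ⟨i, hi⟩ := exists_pos_of_mem_stdSimplex hq
  have hi1 : q i = 1 := by
    have := hz i (Finset.mem_univ i)
    rw [neg_eq_zero, mul_eq_zero] at this
    exact eq_one_of_pos_of_log_eq_zero hi (this.resolve_left hi.ne')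
  have hj : ∀ j, j ≠ i → p j = 0 := by
    intro j hj
    refine hpq j (le_antisymm ?_ (hq.1 j))
    have h1 := hq.2
    rw [sum_eq_pair_add q hj, hi1] at h1
    have : 0 ≤ ∑ k ∈ (Finset.univ.erase j).erase i, q k := Finset.sum_nonneg fun k _ => hq.1 k
    linarith
  have hpi : p i = 1 := by
    rw [← hp.2]
    exact (Finset.sum_eq_single i (fun j _ h => hj j h) (by simp)).symm
  refine Finset.sum_eq_zero fun j _ => ?_
  by_cases h : j = i
  · rw [h, hpi]; simp
  · rw [hj j h]; simp

lemma ofReal_log_le_relEntropy (hd : 2 ≤ d) {p q : Fin d → ℝ} (hp : p ∈ stdSimplex ℝ (Fin d))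
    (hq : q ∈ stdSimplex ℝ (Fin d)) (hHp : shEntropy p = 0) (hHq : shEntropy q = log d) :
    ENNReal.ofReal (log d) ≤ relEntropy p q := by
  rw [relEntropy]
  split_ifs with hpq
  swap
  · exact le_top
  refine ENNReal.ofReal_le_ofReal ?_
  obtain ⟨i, hi⟩ := exists_le_max hd q
  have h1 := neg_log_le_sum_mul_log_div hp hq hpq hi
  have hm : 0 < q i := by
    obtain ⟨j, hj⟩ := exists_pos_of_mem_stdSimplex hq
    exact hj.trans_le (hi j)
  have hmono : StrictMonoOn (qaryEntropy d) (Icc 0 (((d : ℝ) - 1) / d)) := by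
    rw [range_bound_eq hd]; exact qaryEntropy_strictMonoOn hd
  have hb := range_bound_pos hd
  have hle : ((d : ℝ) - 1) / d ≤ 1 - q i := by
    by_contra! h
    obtain ⟨r, hr, hrb⟩ := exists_between (max_lt h hb)
    obtain ⟨hr1, hr0⟩ := max_lt_iff.1 hr
    have h2 := shEntropy_le_tangent hd hq i hr0 (hrb.trans (range_bound_lt_one hd))
    have h3 := hmono ⟨hr0.le, hrb.le⟩ ⟨hb.le, le_rfl⟩ hrb
    rw [qaryEntropy_range_bound hd] at h3
    nlinarith [entropySlope_pos hd hr0 hrb]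
  have h2 : q i ≤ 1 / d := by rw [range_bound_eq hd] at hle; linarith
  have h3 := log_le_log hm h2
  rw [one_div, log_inv] at h3
  linarith

/-- The first inequality: the total relative entropy is at least `k` times `Mfun`. -/
lemma mul_Mfun_le_sum (hd : 2 ≤ d) {k : ℕ} (hk : 1 ≤ k) {ρ : ℕ → Fin d → ℝ}
    (hρ : ∀ j ≤ k, ρ j ∈ stdSimplex ℝ (Fin d)) :
    (k : ℝ≥0∞) * Mfun ((shEntropy (ρ 0) - shEntropy (ρ k)) / k) d ≤
      ∑ j ∈ Finset.range k, relEntropy (ρ j) (ρ (j + 1)) := by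
  have hk' : (1 : ℝ) ≤ k := by exact_mod_cast hk
  have a0 := shEntropy_nonneg (hρ 0 (by omega))
  have b0 := shEntropy_nonneg (hρ k le_rfl)
  have a1 := shEntropy_le_log hd (hρ 0 (by omega))
  have b1 := shEntropy_le_log hd (hρ k le_rfl)
  have hlog : 0 < log (d : ℝ) := log_pos (by exact_mod_cast hd)
  obtain ⟨Δ, hΔ⟩ : ∃ Δ, Δ = (shEntropy (ρ 0) - shEntropy (ρ k)) / k := ⟨_, rfl⟩
  have hkΔ : k * Δ = shEntropy (ρ 0) - shEntropy (ρ k) := by rw [hΔ]; field_simp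
  rw [← hΔ]
  have hk1 : log d ≤ |Δ| → k = 1 := by
    intro h
    have h1 : k * |Δ| ≤ log d := by
      rw [← abs_of_nonneg (show (0 : ℝ) ≤ k by linarith), ← abs_mul, hkΔ]
      exact abs_le.2 ⟨by linarith, by linarith⟩
    have h2 : (k : ℝ) ≤ 1 := by
      by_contra! h3
      nlinarith
    exact le_antisymm (by exact_mod_cast h2) hk
  rcases lt_trichotomy Δ 0 with hneg | hzero | hpos
  · rcases lt_or_ge (-Δ) (log d) with hlt | hge
    · obtain ⟨s, r, slope, hs, hr, h0, h1, hsup⟩ :=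
        exists_isSupporting_of_neg hd (neg_pos.2 hneg) hlt
      rw [neg_neg] at h1
      rw [← h1]
      exact mul_Mfun_le_sum_of_isSupporting hd hρ hs hr h0 (by rw [h1, hkΔ]) hsup
    · obtain rfl := hk1 (by rwa [abs_of_neg hneg])
      rw [Nat.cast_one, one_mul] at hkΔ
      have hr : ((d : ℝ) - 1) / d ∈ Icc 0 (((d : ℝ) - 1) / d) := ⟨(range_bound_pos hd).le, le_rfl⟩
      have h1 := Mfun_le_ofReal_binKL hd ⟨le_rfl, hr.1⟩ hr (range_bound_pos hd)
      have hkl : binKL 0 (((d : ℝ) - 1) / d) = log d := by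
        rw [binKL, range_bound_eq hd]; simp
      have hΔ' : Δ = -log d := by linarith
      rw [qaryEntropy_zero, qaryEntropy_range_bound hd, hkl, zero_sub, ← hΔ'] at h1
      simpa using h1.trans (ofReal_log_le_relEntropy hd (hρ 0 (by omega)) (hρ 1 le_rfl)
        (by linarith) (by linarith))
  · rw [hzero, Mfun_zero hd, mul_zero]
    exact zero_le
  · rcases lt_or_ge Δ (log d) with hlt | hge
    · obtain ⟨s, r, slope, hs, hr, h0, h1, hsup⟩ := exists_isSupporting_of_pos hd hpos hlt
      rw [← h1]
      exact mul_Mfun_le_sum_of_isSupporting hd hρ hs hr h0 (by rw [h1, hkΔ]) hsup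
    · obtain rfl := hk1 (by rwa [abs_of_pos hpos])
      rw [Nat.cast_one, one_mul] at hkΔ
      rw [Finset.sum_range_one, relEntropy_eq_top (hρ 0 (by omega)) (hρ 1 le_rfl)
        (by linarith) (by linarith)]
      exact le_top

end

end

/-- degree of irreversibility of a stepwise process. -/
theorem stepwise_irreversibility (d k : ℕ) (hd : 2 ≤ d) (hk : 1 ≤ k)
    (ρ : ℕ → Fin d → ℝ)
    (hρ0 : ∀ j ≤ k, ∀ i, 0 ≤ ρ j i) (hρ1 : ∀ j ≤ k, ∑ i, ρ j i = 1) :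
    (k : ℝ≥0∞) * Mfun (-(shEntropy (ρ k) - shEntropy (ρ 0)) / k) d ≤
        ∑ j ∈ Finset.range k, relEntropy (ρ j) (ρ (j + 1)) ∧
    ENNReal.ofReal ((shEntropy (ρ k) - shEntropy (ρ 0))^2 / (3 * k * (Real.log d)^2)) ≤
        (k : ℝ≥0∞) * Mfun (-(shEntropy (ρ k) - shEntropy (ρ 0)) / k) d := by
  rw [neg_sub]
  refine ⟨mul_Mfun_le_sum hd hk fun j hj => ⟨hρ0 j hj, hρ1 j hj⟩, ?_⟩
  have hk' : (1 : ℝ) ≤ k := by exact_mod_cast hk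
  calc ENNReal.ofReal ((shEntropy (ρ k) - shEntropy (ρ 0)) ^ 2 / (3 * k * Real.log d ^ 2))
      = ENNReal.ofReal (k * (((shEntropy (ρ 0) - shEntropy (ρ k)) / k) ^ 2 /
          (3 * Real.log d ^ 2))) := by
        congr 1
        have : 0 < Real.log (d : ℝ) := Real.log_pos (by exact_mod_cast hd)
        field_simp
        ring
    _ = k * ENNReal.ofReal (((shEntropy (ρ 0) - shEntropy (ρ k)) / k) ^ 2 / (3 * Real.log d ^ 2)) := by
        rw [ENNReal.ofReal_mul (by linarith), ENNReal.ofReal_natCast]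
    _ ≤ _ := by gcongr; exact ofReal_sq_le_Mfun hd _

end
end

section
/- Let d ≥ 2 be an integer and let σ, ρ be probability vectors on Fin d such that every i with ρ i = 0 also has σ i = 0. Set Δ = H(σ) - H(ρ). Then the (finite, real-valued) relative entropy D(σ‖ρ) = ∑ i, σ i · log(σ i / ρ i) satisfies D(σ‖ρ) ≥ Δ²/(2·(log d)²) + Δ³/(6·(log d)⁴). -/
open scoped ENNReal BigOperators

noncomputable section

section Auxiliary

open Real Finset

/-- A function with nonnegative second derivative on an open interval lies above a horizontal
tangent. -/
lemma le_of_second_deriv_nonneg {D : Set ℝ} (hD : Convex ℝ D) (hDo : IsOpen D)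
    {f f' f'' : ℝ → ℝ} (hf : ∀ x ∈ D, HasDerivAt f (f' x) x)
    (hf' : ∀ x ∈ D, HasDerivAt f' (f'' x) x) (hf'' : ∀ x ∈ D, 0 ≤ f'' x)
    {a : ℝ} (ha : a ∈ D) (h0 : f' a = 0) {x : ℝ} (hx : x ∈ D) : f a ≤ f x := by
  have hconv : ConvexOn ℝ D f := by
    refine convexOn_of_hasDerivWithinAt2_nonneg (f' := f') (f'' := f'') hD
      (fun y hy => (hf y hy).continuousAt.continuousWithinAt) ?_ ?_ ?_ <;>
      rw [hDo.interior_eq]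
    · exact fun y hy => (hf y hy).hasDerivWithinAt
    · exact fun y hy => (hf' y hy).hasDerivWithinAt
    · exact hf''
  rcases lt_trichotomy a x with h | h | h
  · have := hconv.le_slope_of_hasDerivAt ha hx h (hf a ha)
    rw [h0, slope_def_field, le_div_iff₀ (sub_pos.2 h)] at this
    linarith
  · rw [h]
  · have := hconv.slope_le_of_hasDerivAt hx ha h (hf a ha)
    rw [h0, slope_def_field, div_le_iff₀ (sub_pos.2 h)] at this
    linarith

lemma cubic_le_exp (x : ℝ) : 1 + x + x ^ 2 / 2 + x ^ 3 / 6 ≤ exp x := by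
  have h := le_of_second_deriv_nonneg (D := Set.univ) convex_univ isOpen_univ
    (f := fun x => exp x - (1 + x + x ^ 2 / 2 + x ^ 3 / 6))
    (f' := fun x => exp x - (1 + x + x ^ 2 / 2)) (f'' := fun x => exp x - (1 + x))
    (fun y _ => by
      refine ((hasDerivAt_exp y).sub ((((hasDerivAt_id y).const_add 1).add
        ((hasDerivAt_pow 2 y).div_const 2)).add
        ((hasDerivAt_pow 3 y).div_const 6))).congr_deriv ?_
      norm_num
      ring)
    (fun y _ => by
      refine ((hasDerivAt_exp y).sub (((hasDerivAt_id y).const_add 1).add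
        ((hasDerivAt_pow 2 y).div_const 2))).congr_deriv ?_
      norm_num)
    (fun y _ => by linarith [add_one_le_exp y]) (a := 0) trivial (by simp) (x := x) trivial
  norm_num at h
  linarith

lemma quartic_le_cosh (x : ℝ) : 1 + x ^ 2 / 2 + x ^ 4 / 24 ≤ cosh x := by
  have h := le_of_second_deriv_nonneg (D := Set.univ) convex_univ isOpen_univ
    (f := fun x => cosh x - (1 + x ^ 2 / 2 + x ^ 4 / 24))
    (f' := fun x => sinh x - (x + x ^ 3 / 6)) (f'' := fun x => cosh x - (1 + x ^ 2 / 2))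
    (fun y _ => by
      refine ((hasDerivAt_cosh y).sub ((((hasDerivAt_pow 2 y).div_const 2).const_add 1).add
        ((hasDerivAt_pow 4 y).div_const 24))).congr_deriv ?_
      norm_num
      ring)
    (fun y _ => by
      refine ((hasDerivAt_sinh y).sub ((hasDerivAt_id y).add
        ((hasDerivAt_pow 3 y).div_const 6))).congr_deriv ?_
      norm_num
      ring)
    (fun y _ => by
      rw [cosh_eq]
      linarith [cubic_le_exp y, cubic_le_exp (-y)]) (a := 0) trivial (by simp) (x := x) trivial
  norm_num at h
  linarith

lemma le_log_two_mul_cosh (s : ℝ) : s ≤ log 2 * cosh s := by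
  have h2 := log_two_gt_d9
  have h := quartic_le_cosh s
  have hc := one_le_cosh s
  have : s ≤ 0.693 * (1 + s ^ 2 / 2 + s ^ 4 / 24) := by
    nlinarith [sq_nonneg (s ^ 2 - 1.44), sq_nonneg (s - 1.2)]
  nlinarith

lemma log_three_gt : 1.097 < log 3 := by
  have h2 := log_two_gt_d9
  have h : log ((2 : ℝ) ^ 19) ≤ log ((3 : ℝ) ^ 12) := log_le_log (by norm_num) (by norm_num)
  rw [log_pow, log_pow] at h
  norm_num at h
  linarith

lemma exp_three_halves_gt : 4.48 < exp (3 / 2) := by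
  have h1 := exp_one_gt_d9
  have h : exp (3 / 2) ^ 2 = exp 1 ^ 3 := by
    rw [← exp_nat_mul, ← exp_nat_mul]
    norm_num
  have h3 : (2.718 : ℝ) ^ 3 < exp 1 ^ 3 := by gcongr; linarith
  by_contra! hc
  have := exp_pos (3 / 2)
  nlinarith

lemma mul_add_le_exp {L y : ℝ} (hL : 1.097 ≤ L) (hy : -L ≤ y) :
    L * y + y ^ 2 ≤ 3 / 4 * L ^ 2 * exp y := by
  rcases le_total y 0 with h0 | h0
  · have h1 : L * y + y ^ 2 ≤ 0 := by nlinarith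
    have := exp_pos y
    exact h1.trans (by positivity)
  · have he : 4.48 * (1 + (y - 3/2) + (y - 3/2) ^ 2 / 2 + (y - 3/2) ^ 3 / 6) ≤ exp y := by
      have h1 := cubic_le_exp (y - 3/2)
      have h2 := exp_three_halves_gt
      have h3 : exp y = exp (3/2) * exp (y - 3/2) := by rw [← exp_add]; ring_nf
      have := exp_pos (y - 3/2)
      rw [h3]
      nlinarith
    obtain ⟨z, rfl⟩ : ∃ z, y = L * z := ⟨y / L, by field_simp⟩
    have hz : 0 ≤ z := by
      by_contra! hz
      nlinarith
    have hz' : 1.097 * z ≤ L * z := by gcongr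
    have key : z + z ^ 2 ≤ 3 / 4 * exp (L * z) := by
      set y := L * z
      have : 1.097 * z + 1.097 * z * (1.097 * z) / 1.097 ≤ y + y * y / 1.097 := by gcongr
      have h3 : (y + y * y / 1.097) / 1.097 ≤
          3 / 4 * (4.48 * (1 + (y - 3/2) + (y - 3/2) ^ 2 / 2 + (y - 3/2) ^ 3 / 6)) := by
        norm_num
        nlinarith [mul_nonneg h0 (sq_nonneg (y - 31/20)), sq_nonneg (y - 6/5)]
      norm_num at this h3 he ⊢
      linarith
    nlinarith [mul_le_mul_of_nonneg_left key (sq_nonneg L)]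

/-- The surprisal of a probability vector `exp ∘ x` with `k ≥ 3` entries has variance at most
`(log k) ^ 2`. -/
lemma varentropy_le_of_three_le_card {ι : Type*} {S : Finset ι} (hS : 3 ≤ #S) {x : ι → ℝ}
    (hx : ∑ i ∈ S, exp (x i) = 1) :
    ∑ i ∈ S, exp (x i) * x i ^ 2 - (∑ i ∈ S, exp (x i) * x i) ^ 2 ≤ log #S ^ 2 := by
  have hd : (3 : ℝ) ≤ #S := by exact_mod_cast hS
  have hL : 1.097 ≤ log #S := log_three_gt.le.trans (log_le_log (by norm_num) hd)
  have hexp : exp (log #S) = #S := exp_log (by linarith)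
  set L := log (#S : ℝ)
  have hbound : ∀ i ∈ S, exp (x i) * (x i + L / 2) ^ 2 ≤
      L ^ 2 / 4 * exp (x i) + 3 / 4 * L ^ 2 / #S := by
    intro i hi
    have hle : exp (x i) ≤ 1 :=
      hx ▸ single_le_sum (f := fun i => exp (x i)) (fun j _ => (exp_pos _).le) hi
    have hi0 : x i ≤ 0 := exp_le_one_iff.1 hle
    have h := mul_add_le_exp (y := -x i - L) hL (by linarith)
    have he : exp (x i) * exp (-x i - L) = 1 / #S := by
      rw [← exp_add, ← hexp, one_div, ← exp_neg]
      ring_nf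
    have h2 := mul_le_mul_of_nonneg_left h (exp_pos (x i)).le
    have h3 : exp (x i) * (3 / 4 * L ^ 2 * exp (-x i - L)) = 3 / 4 * L ^ 2 / #S := by
      rw [mul_left_comm, he]; ring
    rw [h3] at h2
    linarith
  have hsum := sum_le_sum hbound
  rw [sum_add_distrib, ← mul_sum, hx, sum_const, nsmul_eq_mul,
    mul_div_cancel₀ _ (by linarith : (#S : ℝ) ≠ 0)] at hsum
  have hexpand : ∑ i ∈ S, exp (x i) * (x i + L / 2) ^ 2 = ∑ i ∈ S, exp (x i) * x i ^ 2 +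
      L * ∑ i ∈ S, exp (x i) * x i + L ^ 2 / 4 * ∑ i ∈ S, exp (x i) := by
    rw [mul_sum, mul_sum, ← sum_add_distrib, ← sum_add_distrib]
    exact sum_congr rfl fun i _ => by ring
  rw [hexpand, hx] at hsum
  nlinarith [sq_nonneg (∑ i ∈ S, exp (x i) * x i + L / 2)]

lemma varentropy_le_of_pair {a b : ℝ} (h : exp a + exp b = 1) :
    exp a * a ^ 2 + exp b * b ^ 2 - (exp a * a + exp b * b) ^ 2 ≤ log 2 ^ 2 := by
  obtain ⟨m, s, rfl, rfl⟩ : ∃ m s : ℝ, a = m + s ∧ b = m - s :=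
    ⟨(a + b) / 2, (a - b) / 2, by ring, by ring⟩
  have hcosh : exp m * (2 * cosh s) = 1 := by
    rw [← h, cosh_eq, sub_eq_add_neg, exp_add, exp_add]; ring
  have hm := exp_pos m
  have hvar : exp (m + s) * (m + s) ^ 2 + exp (m - s) * (m - s) ^ 2 -
      (exp (m + s) * (m + s) + exp (m - s) * (m - s)) ^ 2 = (2 * (exp m * s)) ^ 2 := by
    have hprod : exp (m + s) * exp (m - s) = exp m ^ 2 := by
      rw [← exp_add, ← exp_nat_mul]; ring_nf
    rw [mul_pow, mul_pow, ← hprod]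
    rw [← eq_sub_iff_add_eq'] at h
    rw [h]
    ring
  rw [hvar]
  refine sq_le_sq' ?_ ?_
  · have := le_log_two_mul_cosh (-s)
    rw [cosh_neg] at this
    linear_combination 2 * exp m * this + log 2 * hcosh
  · have := le_log_two_mul_cosh s
    linear_combination 2 * exp m * this + log 2 * hcosh

lemma varentropy_le {ι : Type*} {S : Finset ι} {x : ι → ℝ} (hx : ∑ i ∈ S, exp (x i) = 1) :
    ∑ i ∈ S, exp (x i) * x i ^ 2 - (∑ i ∈ S, exp (x i) * x i) ^ 2 ≤ log #S ^ 2 := by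
  classical
  rcases le_or_gt 3 #S with h3 | h3
  · exact varentropy_le_of_three_le_card h3 hx
  interval_cases h : #S
  · simp [card_eq_zero.1 h]
  · obtain ⟨i, rfl⟩ := card_eq_one.1 h
    simp only [sum_singleton] at hx ⊢
    simp [hx]
  · obtain ⟨i, j, hij, rfl⟩ := card_eq_two.1 h
    rw [sum_pair hij] at hx
    rw [sum_pair hij, sum_pair hij]
    exact_mod_cast varentropy_le_of_pair hx

/-- Bound on the log-partition function of the exponential family through `exp ∘ e`. -/
lemma log_partition_le {ι : Type*} {S : Finset ι} {e : ι → ℝ} (he : ∑ i ∈ S, exp (e i) = 1)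
    {N : ℝ} (hN : log #S ^ 2 ≤ N) {β : ℝ} (hβ : 0 < β) :
    log (∑ i ∈ S, exp (β * e i)) ≤
      (β - 1) * ∑ i ∈ S, exp (e i) * e i + N * (β - 1 - log β) := by
  have hSne : S.Nonempty := nonempty_of_ne_empty (by rintro rfl; simp at he)
  set Z : ℝ → ℝ := fun t => ∑ i ∈ S, exp (t * e i)
  set Z₁ : ℝ → ℝ := fun t => ∑ i ∈ S, exp (t * e i) * e i
  set Z₂ : ℝ → ℝ := fun t => ∑ i ∈ S, exp (t * e i) * e i ^ 2
  have hZpos : ∀ t, 0 < Z t := fun t => sum_pos (fun i _ => exp_pos _) hSne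
  have hZ : ∀ t, HasDerivAt Z (Z₁ t) t := fun t =>
    HasDerivAt.fun_sum fun i _ => by
      simpa using ((hasDerivAt_id t).mul_const (e i)).exp
  have hZ₁ : ∀ t, HasDerivAt Z₁ (Z₂ t) t := fun t =>
    HasDerivAt.fun_sum fun i _ => by
      refine ((((hasDerivAt_id t).mul_const (e i)).exp).mul_const (e i)).congr_deriv ?_
      simp only [id]
      ring
  have hZone : Z 1 = 1 := by simpa [Z] using he
  have hvar : ∀ t, t ^ 2 * (Z₂ t / Z t - (Z₁ t / Z t) ^ 2) ≤ N := by
    intro t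
    have hne := (hZpos t).ne'
    have hp : ∀ i, exp (t * e i - log (Z t)) = exp (t * e i) / Z t := fun i => by
      rw [exp_sub, exp_log (hZpos t)]
    have hone : ∑ i ∈ S, exp (t * e i - log (Z t)) = 1 := by
      simp_rw [hp]
      rw [← sum_div, div_self hne]
    refine le_trans (le_of_eq ?_) ((varentropy_le hone).trans hN)
    have h₁ : ∑ i ∈ S, exp (t * e i - log (Z t)) * (t * e i - log (Z t)) =
        t * (Z₁ t / Z t) - log (Z t) := by
      calc _ = t * (∑ i ∈ S, exp (t * e i) * e i) / Z t
            - log (Z t) * ∑ i ∈ S, exp (t * e i - log (Z t)) := by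
              rw [mul_sum, mul_sum, sum_div, ← sum_sub_distrib]
              exact sum_congr rfl fun i _ => by rw [hp]; ring
        _ = _ := by rw [hone]; ring
    have h₂ : ∑ i ∈ S, exp (t * e i - log (Z t)) * (t * e i - log (Z t)) ^ 2 =
        t ^ 2 * (Z₂ t / Z t) - 2 * log (Z t) * (t * (Z₁ t / Z t)) + log (Z t) ^ 2 := by
      calc _ = t ^ 2 * (∑ i ∈ S, exp (t * e i) * e i ^ 2) / Z t
            - 2 * log (Z t) * t * (∑ i ∈ S, exp (t * e i) * e i) / Z t
            + log (Z t) ^ 2 * ∑ i ∈ S, exp (t * e i - log (Z t)) := by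
              rw [mul_sum, mul_sum, mul_sum, sum_div, sum_div, ← sum_sub_distrib,
                ← sum_add_distrib]
              exact sum_congr rfl fun i _ => by rw [hp]; ring
        _ = _ := by rw [hone]; ring
    rw [h₁, h₂]
    ring
  have h := le_of_second_deriv_nonneg (convex_Ioi (0 : ℝ)) isOpen_Ioi
    (f := fun t => (t - 1) * Z₁ 1 + N * (t - 1 - log t) - log (Z t))
    (f' := fun t => Z₁ 1 + N * (1 - t⁻¹) - Z₁ t / Z t)
    (f'' := fun t => N * (t ^ 2)⁻¹ - (Z₂ t / Z t - (Z₁ t / Z t) ^ 2))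
    (fun t ht => by
      have ht' : t ≠ 0 := ne_of_gt ht
      refine (((((hasDerivAt_id t).sub_const 1).mul_const (Z₁ 1)).add
        ((((hasDerivAt_id t).sub_const 1).sub (hasDerivAt_log ht')).const_mul N)).sub
        ((hZ t).log (hZpos t).ne')).congr_deriv ?_
      ring)
    (fun t ht => by
      have ht' : t ≠ 0 := ne_of_gt ht
      have hne := (hZpos t).ne'
      refine (((((hasDerivAt_inv ht').const_sub 1).const_mul N).const_add (Z₁ 1)).sub
        ((hZ₁ t).div (hZ t) hne)).congr_deriv ?_
      field_simp)
    (fun t ht => by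
      have ht' : 0 < t ^ 2 := pow_pos ht 2
      rw [sub_nonneg, ← div_eq_mul_inv, le_div_iff₀ ht', mul_comm]
      exact hvar t)
    (a := 1) (Set.mem_Ioi.2 one_pos) (by simp [hZone]) (x := β) hβ
  have hZ₁one : Z₁ 1 = ∑ i ∈ S, exp (e i) * e i := by simp [Z₁]
  simp only [hZone, hZ₁one, log_one] at h
  linarith

/-- Gibbs' variational inequality. -/
lemma gibbs_le_log_sum_exp {ι : Type*} {S : Finset ι} (p w : ι → ℝ)
    (hp0 : ∀ i ∈ S, 0 ≤ p i) (hp1 : ∑ i ∈ S, p i = 1) :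
    ∑ i ∈ S, p i * (w i - log (p i)) ≤ log (∑ i ∈ S, exp (w i)) := by
  have hSne : S.Nonempty := nonempty_of_ne_empty (by rintro rfl; simp at hp1)
  set Z := ∑ i ∈ S, exp (w i)
  have hZpos : 0 < Z := sum_pos (fun i _ => exp_pos _) hSne
  have hterm : ∀ i ∈ S, p i * (w i - log (p i)) ≤
      p i * log Z + (exp (w i) / Z - p i) := by
    intro i hi
    rcases (hp0 i hi).eq_or_lt with h0 | h0
    · rw [← h0]
      have := exp_pos (w i)
      simp only [zero_mul, zero_add, sub_zero]
      positivity
    · have h := add_one_le_exp (w i - log Z - log (p i))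
      rw [exp_sub, exp_sub, exp_log hZpos, exp_log h0, le_div_iff₀ h0] at h
      linarith
  have h := sum_le_sum hterm
  rwa [sum_add_distrib, sum_sub_distrib, ← sum_mul, ← sum_div, hp1, div_self hZpos.ne',
    sub_self, add_zero, one_mul] at h

/-- Exponential lower bound on the relative entropy of `σ` with respect to `exp ∘ e`. -/
lemma exp_bound_le_relEntropy {ι : Type*} {S : Finset ι} {σ e : ι → ℝ}
    (hσ0 : ∀ i ∈ S, 0 ≤ σ i) (hσ1 : ∑ i ∈ S, σ i = 1) (he : ∑ i ∈ S, exp (e i) = 1)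
    {N Δ : ℝ} (hNpos : 0 < N) (hN : log #S ^ 2 ≤ N)
    (hΔ : Δ = ∑ i ∈ S, exp (e i) * e i - ∑ i ∈ S, σ i * log (σ i)) :
    N * (exp (Δ / N) - 1 - Δ / N) ≤ ∑ i ∈ S, σ i * (log (σ i) - e i) := by
  set β := exp (-(Δ / N)) with hβ
  have hβpos : 0 < β := exp_pos _
  have hgibbs := gibbs_le_log_sum_exp σ (fun i => β * e i) hσ0 hσ1
  have hpart := log_partition_le he hN hβpos
  have hlog : N * log β = -Δ := by
    rw [hβ, log_exp]
    field_simp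
  have hmul : exp (Δ / N) * β = 1 := by rw [hβ, ← exp_add, add_neg_cancel, exp_zero]
  have hg : ∑ i ∈ S, σ i * (β * e i - log (σ i)) =
      β * ∑ i ∈ S, σ i * e i - ∑ i ∈ S, σ i * log (σ i) := by
    rw [mul_sum, ← sum_sub_distrib]
    exact sum_congr rfl fun i _ => by ring
  have hD : ∑ i ∈ S, σ i * (log (σ i) - e i) =
      ∑ i ∈ S, σ i * log (σ i) - ∑ i ∈ S, σ i * e i := by
    rw [← sum_sub_distrib]
    exact sum_congr rfl fun i _ => by ring
  rw [hg] at hgibbs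
  rw [hD]
  set A := ∑ i ∈ S, σ i * log (σ i)
  set B := ∑ i ∈ S, σ i * e i
  set C := ∑ i ∈ S, exp (e i) * e i
  have h1 : N ≤ β * (A - B + Δ + N) := by
    rw [hΔ] at hlog ⊢
    linarith
  have h2 := mul_le_mul_of_nonneg_left h1 (exp_pos (Δ / N)).le
  rw [← mul_assoc, hmul, one_mul] at h2
  have h3 : N * (Δ / N) = Δ := mul_div_cancel₀ _ hNpos.ne'
  linarith

end Auxiliary

/-- real-valued quadratic-cubic lower bound on the relative entropy. -/
theorem relEntropy_real_lower_bound (d : ℕ) (hd : 2 ≤ d) (σ ρ : Fin d → ℝ)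
    (hσ0 : ∀ i, 0 ≤ σ i) (hσ1 : ∑ i, σ i = 1)
    (hρ0 : ∀ i, 0 ≤ ρ i) (hρ1 : ∑ i, ρ i = 1)
    (habs : ∀ i, ρ i = 0 → σ i = 0) :
    ∑ i, σ i * Real.log (σ i / ρ i) ≥
      (shEntropy σ - shEntropy ρ)^2 / (2 * (Real.log d)^2) +
        (shEntropy σ - shEntropy ρ)^3 / (6 * (Real.log d)^4) := by
  classical
  have hLpos : 0 < Real.log d := Real.log_pos (by exact_mod_cast hd)
  set S : Finset (Fin d) := Finset.univ.filter (fun i => ρ i ≠ 0) with hS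
  have hmem : ∀ i, i ∉ S → ρ i = 0 := fun i hi => by simpa [hS] using hi
  have hsupp : ∀ f : Fin d → ℝ, (∀ i, ρ i = 0 → f i = 0) → ∑ i ∈ S, f i = ∑ i, f i :=
    fun f hf => Finset.sum_subset (Finset.subset_univ S) fun i _ hi => hf i (hmem i hi)
  have hexp : ∀ i ∈ S, Real.exp (Real.log (ρ i)) = ρ i := fun i hi =>
    Real.exp_log ((hρ0 i).lt_of_ne' (by simpa [hS] using hi))
  have hσS : ∑ i ∈ S, σ i = 1 := by rw [hsupp σ habs, hσ1]
  have hρS : ∑ i ∈ S, Real.exp (Real.log (ρ i)) = 1 := by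
    rw [Finset.sum_congr rfl hexp, hsupp ρ fun _ h => h, hρ1]
  have hSne : S.Nonempty := Finset.nonempty_of_ne_empty fun h => by simp [h] at hσS
  have hN : Real.log S.card ^ 2 ≤ Real.log d ^ 2 := by
    have hcard : S.card ≤ d := by simpa using S.card_le_univ
    have hpos : (1 : ℝ) ≤ S.card := by exact_mod_cast hSne.card_pos
    have := Real.log_nonneg hpos
    gcongr
  have hΔ : shEntropy σ - shEntropy ρ = ∑ i ∈ S, Real.exp (Real.log (ρ i)) * Real.log (ρ i) -
      ∑ i ∈ S, σ i * Real.log (σ i) := by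
    rw [Finset.sum_congr rfl fun i hi => by rw [hexp i hi],
      hsupp (fun i => ρ i * Real.log (ρ i)) fun i h => by simp [h],
      hsupp (fun i => σ i * Real.log (σ i)) fun i h => by simp [habs i h]]
    simp only [shEntropy, Finset.sum_neg_distrib]
    ring
  have hD : ∑ i, σ i * Real.log (σ i / ρ i) =
      ∑ i ∈ S, σ i * (Real.log (σ i) - Real.log (ρ i)) := by
    rw [← hsupp _ fun i h => by simp [habs i h]]
    refine Finset.sum_congr rfl fun i hi => ?_
    rcases eq_or_ne (σ i) 0 with h | h
    · simp [h]
    · rw [Real.log_div h (by simpa [hS] using hi)]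
  have hNpos : 0 < Real.log d ^ 2 := by positivity
  have hmain := exp_bound_le_relEntropy (fun i _ => hσ0 i) hσS hρS hNpos hN hΔ
  rw [hD]
  refine le_trans (le_of_eq ?_) ((mul_le_mul_of_nonneg_left
    (sub_le_sub_right (sub_le_sub_right (cubic_le_exp _) 1) _) hNpos.le).trans hmain)
  field_simp
  ring

end
end
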